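/- arXiv:2102.13436 — 3 statements merged into one kernel-verified Lean document; each statement's English description precedes it below -/
import Mathlib

section
/- Let s ∈ (0,1), p ∈ [2,∞), N ≥ 2 an integer with sp ≤ N, and let f : ℝ → ℝ be an odd continuous function satisfying (f1), (f3), and additionally (f2) if sp < N or (f4) if sp = N. Then for every n ∈ ℕ there exists a continuous odd map π_n : S^{n−1} → W_r^{s,p}(ℝ^N) (continuity with respect to the norm ‖·‖_{s,p}) such that 0 ∉ π_n(S^{n−1}) and ∫_{ℝ^N} F(π_n(σ)) dx ≥ 1 for all σ ∈ S^{n−1}, where F(t) = ∫_0^t f(τ)dτ. -/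
open MeasureTheory Real Filter Topology Set

noncomputable section

/-- `ℝ^N` -/
abbrev RN (N : ℕ) := EuclideanSpace ℝ (Fin N)

/-- The `p`-th power of the Gagliardo seminorm `[u]_{s,p}`, as an extended
nonnegative real number:
`[u]_{s,p}^p = ∫∫ |u x - u y|^p / |x-y|^(N+sp) dx dy`. -/
def gagE (N : ℕ) (s p : ℝ) (u : RN N → ℝ) : ENNReal :=
  ∫⁻ x : RN N, ∫⁻ y : RN N,
    ENNReal.ofReal (|u x - u y| ^ p / ‖x - y‖ ^ ((N : ℝ) + s * p))

/-- The `p`-th power of the Gagliardo seminorm, as a real number. -/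
def gagP (N : ℕ) (s p : ℝ) (u : RN N → ℝ) : ℝ := (gagE N s p u).toReal

/-- Membership in the fractional Sobolev space `W^{s,p}(ℝ^N)`:
`u ∈ L^p(ℝ^N)` and `[u]_{s,p} < ∞`. -/
def memW (N : ℕ) (s p : ℝ) (u : RN N → ℝ) : Prop :=
  AEStronglyMeasurable u volume ∧ Integrable (fun x => |u x| ^ p) volume ∧
    gagE N s p u < ⊤

/-- `‖u‖_{s,p}^p = [u]_{s,p}^p + ‖u‖_{L^p}^p`. -/
def sobNormP (N : ℕ) (s p : ℝ) (u : RN N → ℝ) : ℝ :=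
  gagP N s p u + ∫ x : RN N, |u x| ^ p

/-- The norm `‖u‖_{s,p} = ([u]_{s,p}^p + ‖u‖_{L^p}^p)^(1/p)`. -/
def sobNorm (N : ℕ) (s p : ℝ) (u : RN N → ℝ) : ℝ := (sobNormP N s p u) ^ (1 / p)

/-- `u` is radially symmetric: `u x` depends only on `‖x‖`. -/
def radial (N : ℕ) (u : RN N → ℝ) : Prop := ∀ x y : RN N, ‖x‖ = ‖y‖ → u x = u y

/-- Membership in `W_r^{s,p}(ℝ^N)`, the subspace of radial functions. -/
def memWr (N : ℕ) (s p : ℝ) (u : RN N → ℝ) : Prop := memW N s p u ∧ radial N u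

/-- The primitive `F(t) = ∫_0^t f(τ) dτ`. -/
def primF (f : ℝ → ℝ) (t : ℝ) : ℝ := ∫ τ in (0:ℝ)..t, f τ

/-- The energy functional `I(u) = (1/p)‖u‖_{s,p}^p - ∫ F(u)`. -/
def ene (N : ℕ) (s p : ℝ) (f : ℝ → ℝ) (u : RN N → ℝ) : ℝ :=
  (1 / p) * sobNormP N s p u - ∫ x : RN N, primF f (u x)

/-- The pairing `⟨(-Δ_p)^s u, φ⟩`. -/
def pairA (N : ℕ) (s p : ℝ) (u φ : RN N → ℝ) : ℝ :=
  ∫ x : RN N, ∫ y : RN N,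
    |u x - u y| ^ (p - 2) * (u x - u y) * (φ x - φ y) / ‖x - y‖ ^ ((N : ℝ) + s * p)

/-- The derivative `I'(u)·φ`. -/
def enePrime (N : ℕ) (s p : ℝ) (f : ℝ → ℝ) (u φ : RN N → ℝ) : ℝ :=
  pairA N s p u φ + (∫ x : RN N, |u x| ^ (p - 2) * u x * φ x) -
    ∫ x : RN N, f (u x) * φ x

/-- `u` is a weak solution of `(-Δ_p)^s u = -|u|^{p-2}u + f(u)` in `ℝ^N`:
for every `φ ∈ W^{s,p}(ℝ^N)`,
`⟨(-Δ_p)^s u, φ⟩ + ∫ |u|^{p-2} u φ = ∫ f(u) φ`. -/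
def weakSol (N : ℕ) (s p : ℝ) (f : ℝ → ℝ) (u : RN N → ℝ) : Prop :=
  ∀ φ : RN N → ℝ, memW N s p φ →
    pairA N s p u φ + (∫ x : RN N, |u x| ^ (p - 2) * u x * φ x) =
      ∫ x : RN N, f (u x) * φ x

/-- Hypothesis (f1): `lim_{t→0} f(t)/(|t|^{p-2} t) = 0`. -/
def hypF1 (p : ℝ) (f : ℝ → ℝ) : Prop :=
  Tendsto (fun t => f t / (|t| ^ (p - 2) * t)) (𝓝[≠] (0:ℝ)) (𝓝 0)

/-- Hypothesis (f2): `limsup_{t→+∞} f(t)/t^{p_s^*-1} ≤ 1`, where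
`p_s^* = pN/(N-sp)`. -/
def hypF2 (N : ℕ) (s p : ℝ) (f : ℝ → ℝ) : Prop :=
  Filter.limsup (fun t : ℝ => ((f t / t ^ (p * N / ((N : ℝ) - s * p) - 1) : ℝ) : EReal))
    atTop ≤ 1

/-- Hypothesis (f3): there are `μ > 0` and `q ∈ (p,∞)` with `f(t) ≥ μ t^{q-1}`
for all `t ≥ 0`. -/
def hypF3 (p : ℝ) (f : ℝ → ℝ) : Prop :=
  ∃ μ > (0:ℝ), ∃ q : ℝ, p < q ∧ ∀ t ≥ (0:ℝ), μ * t ^ (q - 1) ≤ f t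

/-- Hypothesis (f4) with threshold `α₀`:
`lim_{t→+∞} f(t)/e^{α t^{N/(N-s)}} = 0` for `α > α₀` and `= +∞` for `0 < α < α₀`. -/
def hypF4 (N : ℕ) (s : ℝ) (f : ℝ → ℝ) (α₀ : ℝ) : Prop :=
  (∀ α > α₀, Tendsto (fun t => f t / Real.exp (α * t ^ ((N : ℝ) / ((N : ℝ) - s))))
      atTop (𝓝 0)) ∧
  (∀ α : ℝ, 0 < α → α < α₀ →
    Tendsto (fun t => f t / Real.exp (α * t ^ ((N : ℝ) / ((N : ℝ) - s)))) atTop atTop)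

/-- `Q_α(t) = e^{α|t|^{p'}} - ∑_{0 ≤ j < p} (α|t|^{p'})^j / j!`, with `p' = p/(p-1)`. -/
def Qfun (p α t : ℝ) : ℝ :=
  Real.exp (α * |t| ^ (p / (p - 1))) -
    ∑ j ∈ Finset.range ⌈p⌉₊, (α * |t| ^ (p / (p - 1))) ^ j / (Nat.factorial j : ℝ)

/-- `G(t) = F(t) - |t|^p/p`, the primitive of `g(t) = -|t|^{p-2}t + f(t)`. -/
def Gfun (p : ℝ) (f : ℝ → ℝ) (t : ℝ) : ℝ := primF f t - |t| ^ p / p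

/-- The best constant `C_q` of the embedding `W^{s,p}(ℝ^N) ↪ L^q(ℝ^N)`:
`C_q = inf { ([u]_{s,p}^p + ‖u‖_{L^p}^p) / ‖u‖_{L^q}^p : u ≠ 0 }`. -/
def CqConst (N : ℕ) (s p q : ℝ) : ℝ :=
  sInf {r : ℝ | ∃ u : RN N → ℝ, memW N s p u ∧ u ≠ 0 ∧
    r = sobNormP N s p u / (∫ x : RN N, |u x| ^ q) ^ (p / q)}

/-- The best fractional Sobolev constant
`S = inf { [u]_{s,p}^p / ‖u‖_{L^{p_s^*}}^p : u ∈ D^{s,p}(ℝ^N), u ≠ 0 }`. -/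
def Sconst (N : ℕ) (s p : ℝ) : ℝ :=
  sInf {r : ℝ | ∃ u : RN N → ℝ,
    Integrable (fun x => |u x| ^ (p * N / ((N : ℝ) - s * p))) volume ∧
    AEStronglyMeasurable u volume ∧ gagE N s p u < ⊤ ∧ u ≠ 0 ∧
    r = gagP N s p u /
      (∫ x : RN N, |u x| ^ (p * N / ((N : ℝ) - s * p))) ^ (p / (p * N / ((N : ℝ) - s * p)))}

/-- The constant `μ*` in hypothesis `(f3)_gs` when `sp < N`. -/
def muStarSub (N : ℕ) (s p q : ℝ) : ℝ :=
  ((p : ℝ) ^ ((s * p - N) / (s * p)) * Sconst N s p ^ (-(N : ℝ) / (s * p)) *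
      ((N : ℝ) / s) *
      (p * N / ((N : ℝ) - s * p)) ^ (((N : ℝ) - s * p) / (s * p))) ^ ((q - p) / p) *
    ((q - p) / (p * q)) ^ ((q - p) / p) * CqConst N s p q ^ (q / p)

/-- The constant `μ*` in hypothesis `(f3)_gs` when `sp = N`. -/
def muStarEq (N : ℕ) (s p q : ℝ) : ℝ :=
  ((q - p) / (p * q)) ^ ((q - p) / p) * CqConst N s p q ^ (q / p)

/-- Hypothesis (f5): `f(t)t - pF(t) ≥ 0` for `t > 0`, and `F ≥ 0`. -/
def hypF5 (p : ℝ) (f : ℝ → ℝ) : Prop :=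
  (∀ t > (0:ℝ), 0 ≤ f t * t - p * primF f t) ∧ ∀ t : ℝ, 0 ≤ primF f t

/-- The ground state level `m = inf { I(v) : v ∈ W^{s,p}(ℝ^N) \ {0}, I'(v) = 0 }`. -/
def gsLevel (N : ℕ) (s p : ℝ) (f : ℝ → ℝ) : ℝ :=
  sInf {c : ℝ | ∃ v : RN N → ℝ, memW N s p v ∧ v ≠ 0 ∧ weakSol N s p f v ∧
    c = ene N s p f v}

/-- Continuity of a path `γ : [0,1] → W^{s,p}(ℝ^N)` with respect to `‖·‖_{s,p}`. -/
def pathCont (N : ℕ) (s p : ℝ) (γ : ℝ → RN N → ℝ) : Prop :=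
  ∀ t ∈ Set.Icc (0:ℝ) 1, ∀ ε > (0:ℝ), ∃ δ > (0:ℝ), ∀ t' ∈ Set.Icc (0:ℝ) 1,
    |t - t'| < δ → sobNorm N s p (fun x => γ t x - γ t' x) < ε

/-- The mountain pass level `b = inf_{γ ∈ Γ} max_{t ∈ [0,1]} I(γ(t))`, where
`Γ = { γ : [0,1] → W^{s,p}(ℝ^N) continuous : γ(0) = 0, I(γ(1)) < 0 }`. -/
def mpLevel (N : ℕ) (s p : ℝ) (f : ℝ → ℝ) : ℝ :=
  sInf {c : ℝ | ∃ γ : ℝ → RN N → ℝ, (∀ t ∈ Set.Icc (0:ℝ) 1, memW N s p (γ t)) ∧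
    pathCont N s p γ ∧ γ 0 = 0 ∧ ene N s p f (γ 1) < 0 ∧
    c = sSup ((fun t => ene N s p f (γ t)) '' Set.Icc (0:ℝ) 1)}

/-- The Pohožaev set
`P = { u ∈ W^{s,p}(ℝ^N) \ {0} : ((N-sp)/p)[u]_{s,p}^p = N ∫ G(u) }`. -/
def pohSet (N : ℕ) (s p : ℝ) (f : ℝ → ℝ) : Set (RN N → ℝ) :=
  {u | memW N s p u ∧ u ≠ 0 ∧
    (((N : ℝ) - s * p) / p) * gagP N s p u = N * ∫ x : RN N, Gfun p f (u x)}

/-- `p̃ = inf { I(u) : u ∈ P }`. -/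
def pohLevel (N : ℕ) (s p : ℝ) (f : ℝ → ℝ) : ℝ :=
  sInf {c : ℝ | ∃ u ∈ pohSet N s p f, c = ene N s p f u}

/-- The constraint set `M = { u ∈ W^{s,p}(ℝ^N) \ {0} : ∫ G(u) = 1 }`. -/
def Mset (N : ℕ) (s p : ℝ) (f : ℝ → ℝ) : Set (RN N → ℝ) :=
  {u | memW N s p u ∧ u ≠ 0 ∧ (∫ x : RN N, Gfun p f (u x)) = 1}

/-- `D = inf { (1/p)[u]_{s,p}^p : u ∈ M }`. -/
def Dconst (N : ℕ) (s p : ℝ) (f : ℝ → ℝ) : ℝ :=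
  sInf {c : ℝ | ∃ u ∈ Mset N s p f, c = (1 / p) * gagP N s p u}

/-- `J'(u)·φ = ∫ (f(u) - |u|^{p-2}u) φ`. -/
def Jprime (N : ℕ) (s p : ℝ) (f : ℝ → ℝ) (u φ : RN N → ℝ) : ℝ :=
  ∫ x : RN N, (f (u x) - |u x| ^ (p - 2) * u x) * φ x

/-- `(u_j)` is a `(PS)_c` sequence in `W_r^{s,p}(ℝ^N)` for `I`: `I(u_j) → c` and
`sup { |I'(u_j)·φ| : φ ∈ W_r^{s,p}, ‖φ‖_{s,p} ≤ 1 } → 0`. -/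
def PSseq (N : ℕ) (s p : ℝ) (f : ℝ → ℝ) (c : ℝ) (u : ℕ → RN N → ℝ) : Prop :=
  (∀ j, memWr N s p (u j)) ∧
  Tendsto (fun j => ene N s p f (u j)) atTop (𝓝 c) ∧
  (∀ δ > (0:ℝ), ∀ᶠ j in atTop, ∀ φ : RN N → ℝ, memWr N s p φ →
    sobNorm N s p φ ≤ 1 → |enePrime N s p f (u j) φ| ≤ δ)

/-- The radial majorant of the Gagliardo kernel. -/
def kerE (N : ℕ) (s p : ℝ) (z : RN N) : ENNReal :=
  ENNReal.ofReal ((min ‖z‖ 2) ^ p / ‖z‖ ^ ((N : ℝ) + s * p))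

lemma kerE_meas (N : ℕ) (s p : ℝ) : Measurable (kerE N s p) := by
  unfold kerE
  fun_prop

lemma kerE_lt_top (N : ℕ) (s p : ℝ) (hN : 2 ≤ N) (hs : s ∈ Set.Ioo (0:ℝ) 1) (hp : 2 ≤ p) :
    ∫⁻ z : RN N, kerE N s p z < ⊤ := by
  have hs0 := hs.1
  have hs1 := hs.2
  have hsp : 0 < s * p := by nlinarith
  have hsp' : s * p < p := by nlinarith
  have : Nonempty (Fin N) := ⟨⟨0, by omega⟩⟩
  have hint : Integrable (fun z : RN N =>
      (fun r : ℝ => (min r 2) ^ p / r ^ ((N : ℝ) + s * p)) ‖z‖) volume := by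
    rw [integrable_fun_norm_addHaar (μ := (volume : Measure (RN N)))
      (f := fun r : ℝ => (min r 2) ^ p / r ^ ((N : ℝ) + s * p))]
    have hdim : Module.finrank ℝ (RN N) = N := by simp
    rw [hdim]
    have hsplit : Ioi (0:ℝ) = Ioc 0 2 ∪ Ioi 2 := (Ioc_union_Ioi_eq_Ioi (by norm_num)).symm
    have hpw : ∀ r : ℝ, 0 < r → (r ^ (N - 1) : ℝ) = r ^ ((N : ℝ) - 1) := by
      intro r hr
      rw [← Real.rpow_natCast, Nat.cast_sub (by omega), Nat.cast_one]
    rw [hsplit, integrableOn_union]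
    constructor
    · have h1 : IntegrableOn (fun r : ℝ => r ^ (p - s * p - 1)) (Ioc 0 2) := by
        rw [← intervalIntegrable_iff_integrableOn_Ioc_of_le (by norm_num)]
        exact intervalIntegral.intervalIntegrable_rpow' (by linarith)
      refine h1.congr_fun ?_ measurableSet_Ioc
      intro r hr
      have hr0 : 0 < r := hr.1
      simp only [smul_eq_mul]
      rw [min_eq_left hr.2, hpw r hr0, ← Real.rpow_sub hr0, ← Real.rpow_add hr0]
      congr 1; ring
    · have h1 : IntegrableOn (fun r : ℝ => (2:ℝ) ^ p * r ^ (- s * p - 1)) (Ioi 2) :=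
        (integrableOn_Ioi_rpow_of_lt (by nlinarith) (by norm_num)).const_mul _
      refine h1.congr_fun ?_ measurableSet_Ioi
      intro r hr
      have hr2 : 2 < r := hr
      have hr0 : 0 < r := by linarith
      simp only [smul_eq_mul]
      rw [min_eq_right hr2.le, hpw r hr0, div_eq_mul_inv, ← Real.rpow_neg hr0.le,
        mul_left_comm, ← Real.rpow_add hr0]
      congr 2; ring
  have := hint.lintegral_lt_top
  exact this

lemma gagE_le (N : ℕ) (s p : ℝ) (hp : 2 ≤ p) (B M : ℝ) (hM : 0 ≤ M) (w : RN N → ℝ)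
    (hb : ∀ x, |w x| ≤ M) (hl : ∀ x y, |w x - w y| ≤ M * ‖x - y‖)
    (hsupp : ∀ x, B < ‖x‖ → w x = 0) :
    gagE N s p w ≤ ENNReal.ofReal (M ^ p) *
      (2 * (volume (Metric.closedBall (0 : RN N) B) * ∫⁻ z : RN N, kerE N s p z)) := by
  set S := Metric.closedBall (0 : RN N) B with hS
  have hSm : MeasurableSet S := Metric.isClosed_closedBall.measurableSet
  have hkm := kerE_meas N s p
  let g : RN N → ENNReal := S.indicator 1
  have hg : Measurable g := measurable_one.indicator hSm
  have hpt : ∀ x y : RN N,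
      ENNReal.ofReal (|w x - w y| ^ p / ‖x - y‖ ^ ((N : ℝ) + s * p)) ≤
      ENNReal.ofReal (M ^ p) * (g x * kerE N s p (x - y) + g y * kerE N s p (x - y)) := by
    intro x y
    by_cases hxy : x ∉ S ∧ y ∉ S
    · have hx : w x = 0 := hsupp x (by simpa [hS] using hxy.1)
      have hy : w y = 0 := hsupp y (by simpa [hS] using hxy.2)
      rw [hx, hy]
      simp [Real.zero_rpow (show p ≠ 0 by linarith)]
    · have h1 : kerE N s p (x - y) ≤ g x * kerE N s p (x - y) + g y * kerE N s p (x - y) := by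
        by_cases hx : x ∈ S
        · have : g x = 1 := by simp [g, hx]
          rw [this, one_mul]; exact le_self_add
        · have hy : y ∈ S := by tauto
          have : g y = 1 := by simp [g, hy]
          rw [this, one_mul]; exact le_add_self
      refine le_trans ?_ (mul_le_mul_right h1 _)
      unfold kerE
      rw [← ENNReal.ofReal_mul (by positivity)]
      apply ENNReal.ofReal_le_ofReal
      rw [← mul_div_assoc]
      apply div_le_div_of_nonneg_right _ (by positivity)
      rw [← Real.mul_rpow hM (by positivity)]
      apply Real.rpow_le_rpow (abs_nonneg _) _ (by linarith)
      rcases le_total ‖x - y‖ 2 with h | h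
      · rw [min_eq_left h]; exact hl x y
      · rw [min_eq_right h]
        have := abs_sub (w x) (w y)
        linarith [hb x, hb y]
  have hgi : ∫⁻ x, g x = volume S := by
    simp [g, lintegral_indicator_one hSm]
  have e1 : ∫⁻ x : RN N, ∫⁻ y : RN N, g x * kerE N s p (x - y) =
      volume S * ∫⁻ z : RN N, kerE N s p z := by
    have : ∀ x : RN N, ∫⁻ y : RN N, g x * kerE N s p (x - y) =
        g x * ∫⁻ z : RN N, kerE N s p z := by
      intro x
      rw [lintegral_const_mul _ (by fun_prop), lintegral_sub_left_eq_self]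
    simp_rw [this]
    rw [lintegral_mul_const _ hg, hgi]
  have e2 : ∫⁻ x : RN N, ∫⁻ y : RN N, g y * kerE N s p (x - y) =
      volume S * ∫⁻ z : RN N, kerE N s p z := by
    rw [lintegral_lintegral_swap (by fun_prop)]
    have : ∀ y : RN N, ∫⁻ x : RN N, g y * kerE N s p (x - y) =
        g y * ∫⁻ z : RN N, kerE N s p z := by
      intro x
      rw [lintegral_const_mul _ (by fun_prop), lintegral_sub_right_eq_self]
    simp_rw [this]
    rw [lintegral_mul_const _ hg, hgi]
  calc gagE N s p w ≤ ∫⁻ x : RN N, ∫⁻ y : RN N,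
        ENNReal.ofReal (M ^ p) * (g x * kerE N s p (x - y) + g y * kerE N s p (x - y)) :=
        lintegral_mono fun x => lintegral_mono fun y => hpt x y
    _ = ENNReal.ofReal (M ^ p) * (∫⁻ x : RN N, ((∫⁻ y : RN N, g x * kerE N s p (x - y)) +
          ∫⁻ y : RN N, g y * kerE N s p (x - y))) := by
        rw [← lintegral_const_mul' _ _ ENNReal.ofReal_ne_top]
        refine lintegral_congr fun x => ?_
        rw [lintegral_const_mul' _ _ ENNReal.ofReal_ne_top, lintegral_add_left (by fun_prop)]
    _ = _ := by
        rw [lintegral_add_left, e1, e2, two_mul]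
        exact Measurable.lintegral_prod_right' (f := fun z : RN N × RN N =>
          g z.1 * kerE N s p (z.1 - z.2)) (by fun_prop)

lemma memW_and_bound (N : ℕ) (s p : ℝ) (hN : 2 ≤ N) (hs : s ∈ Set.Ioo (0:ℝ) 1) (hp : 2 ≤ p)
    (B : ℝ) : ∃ C : ℝ, 0 ≤ C ∧ ∀ (M : ℝ) (w : RN N → ℝ), 0 ≤ M → (∀ x, |w x| ≤ M) →
    (∀ x y, |w x - w y| ≤ M * ‖x - y‖) → (∀ x, B < ‖x‖ → w x = 0) →
    memW N s p w ∧ sobNormP N s p w ≤ C * M ^ p := by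
  set S := Metric.closedBall (0 : RN N) B with hS
  have hSm : MeasurableSet S := Metric.isClosed_closedBall.measurableSet
  have hSf : volume S < ⊤ := measure_closedBall_lt_top
  set K := (2 * (volume S * ∫⁻ z : RN N, kerE N s p z)) with hK
  have hKf : K < ⊤ := ENNReal.mul_lt_top (by simp)
    (ENNReal.mul_lt_top hSf (kerE_lt_top N s p hN hs hp))
  refine ⟨K.toReal + (volume S).toReal, by positivity, ?_⟩
  intro M w hM hb hl hsupp
  have hc : Continuous w := by
    refine (LipschitzWith.of_dist_le_mul (K := ⟨M, hM⟩) ?_).continuous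
    intro x y
    rw [Real.dist_eq, dist_eq_norm]; exact hl x y
  have hg := gagE_le N s p hp B M hM w hb hl hsupp
  rw [← hS, ← hK] at hg
  have hMp : 0 ≤ M ^ p := Real.rpow_nonneg hM _
  have hle : ∀ x, |w x| ^ p ≤ S.indicator (fun _ => M ^ p) x := by
    intro x
    by_cases hx : x ∈ S
    · rw [Set.indicator_of_mem hx]
      exact Real.rpow_le_rpow (abs_nonneg _) (hb x) (by linarith)
    · rw [Set.indicator_of_notMem hx, hsupp x (by simpa [hS] using hx)]
      simp [Real.zero_rpow (show p ≠ 0 by linarith)]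
  have hii : Integrable (S.indicator (fun _ => M ^ p)) (volume : Measure (RN N)) :=
    (integrable_indicator_iff hSm).2 (integrableOn_const hSf.ne)
  have hcp : Continuous fun x => |w x| ^ p :=
    hc.abs.rpow_const fun x => Or.inr (by linarith)
  have hi : Integrable (fun x => |w x| ^ p) (volume : Measure (RN N)) := by
    refine hii.mono' hcp.aestronglyMeasurable (ae_of_all _ fun x => ?_)
    rw [Real.norm_of_nonneg (by positivity)]; exact hle x
  have hfin : ENNReal.ofReal (M ^ p) * K < ⊤ := ENNReal.mul_lt_top ENNReal.ofReal_lt_top hKf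
  refine ⟨⟨hc.aestronglyMeasurable, hi, hg.trans_lt hfin⟩, ?_⟩
  have h1 : gagP N s p w ≤ M ^ p * K.toReal := by
    have := ENNReal.toReal_mono hfin.ne hg
    rwa [ENNReal.toReal_mul, ENNReal.toReal_ofReal hMp] at this
  have h2 : ∫ x, |w x| ^ p ≤ (volume S).toReal * M ^ p := by
    refine (integral_mono hi hii hle).trans_eq ?_
    rw [integral_indicator hSm, setIntegral_const]
    rfl
  unfold sobNormP
  linarith

lemma primF_lower (f : ℝ → ℝ) (hfc : Continuous f) (hodd : ∀ t : ℝ, f (-t) = -f t)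
    (μ q : ℝ) (hq : 2 < q) (h : ∀ t ≥ (0:ℝ), μ * t ^ (q - 1) ≤ f t) (t : ℝ) :
    μ / q * |t| ^ q ≤ primF f t := by
  have pos : ∀ t : ℝ, 0 ≤ t → μ / q * t ^ q ≤ primF f t := by
    intro t ht
    have e : ∫ τ in (0:ℝ)..t, μ * τ ^ (q - 1) = μ / q * t ^ q := by
      rw [intervalIntegral.integral_const_mul, integral_rpow (Or.inl (by linarith))]
      rw [sub_add_cancel, Real.zero_rpow (by linarith)]
      ring
    rw [← e]
    refine intervalIntegral.integral_mono_on ht ?_ (hfc.intervalIntegrable _ _) ?_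
    · exact (intervalIntegral.intervalIntegrable_rpow' (by linarith)).const_mul _
    · intro x hx; exact h x hx.1
  have ev : ∀ t, primF f (-t) = primF f t := by
    intro t
    have := intervalIntegral.integral_comp_neg (f := f) (a := 0) (b := t)
    simp only [hodd, neg_zero, intervalIntegral.integral_neg] at this
    unfold primF
    rw [intervalIntegral.integral_symm]; linarith
  rcases le_total 0 t with ht | ht
  · rw [abs_of_nonneg ht]; exact pos t ht
  · rw [abs_of_nonpos ht, ← ev]; exact pos _ (by linarith)

/-- Radial bump at radius `3 i + 2`. -/
def bmp (N : ℕ) (i : ℕ) (x : RN N) : ℝ := max 0 (1 - |‖x‖ - (3 * (i : ℝ) + 2)|)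

lemma bmp_abs (N i : ℕ) (x : RN N) : |bmp N i x| ≤ 1 := by
  unfold bmp
  rw [abs_of_nonneg (le_max_left _ _)]
  exact max_le (by norm_num) (by linarith [abs_nonneg (‖x‖ - (3 * (i : ℝ) + 2))])

lemma bmp_lip (N i : ℕ) (x y : RN N) : |bmp N i x - bmp N i y| ≤ ‖x - y‖ := by
  unfold bmp
  refine (abs_max_sub_max_le_max _ _ _ _).trans ?_
  rw [sub_self, abs_zero]
  refine max_le (norm_nonneg _) ?_
  have h1 := abs_abs_sub_abs_le_abs_sub (‖y‖ - (3 * (i : ℝ) + 2)) (‖x‖ - (3 * (i : ℝ) + 2))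
  have h2 := abs_norm_sub_norm_le y x
  rw [sub_sub_sub_cancel_right] at h1
  rw [sub_sub_sub_cancel_left, norm_sub_rev]
  exact h1.trans h2

lemma bmp_zero (N i : ℕ) (x : RN N) (h : 1 ≤ |‖x‖ - (3 * (i : ℝ) + 2)|) : bmp N i x = 0 :=
  max_eq_left (by linarith)

/-- The linear combination of bumps. -/
def comb (N n : ℕ) (R : ℝ) (σ : EuclideanSpace ℝ (Fin n)) (x : RN N) : ℝ :=
  R * ∑ i : Fin n, σ i * bmp N i x

lemma comb_sub (N n : ℕ) (R : ℝ) (σ τ : EuclideanSpace ℝ (Fin n)) :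
    comb N n R σ - comb N n R τ = comb N n R (σ - τ) := by
  funext x
  simp [comb, sub_mul, Finset.sum_sub_distrib, mul_sub]

lemma sum_bound (n : ℕ) (σ : EuclideanSpace ℝ (Fin n)) (a : Fin n → ℝ) (b : ℝ)
    (h : ∀ i, |a i| ≤ b) : |∑ i : Fin n, σ i * a i| ≤ n * ‖σ‖ * b := by
  calc |∑ i : Fin n, σ i * a i| ≤ ∑ i : Fin n, |σ i * a i| := Finset.abs_sum_le_sum_abs _ _
    _ ≤ ∑ i : Fin n, ‖σ‖ * b := by
        refine Finset.sum_le_sum fun i _ => ?_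
        rw [abs_mul]
        exact mul_le_mul (by simpa using PiLp.norm_apply_le σ i) (h i) (abs_nonneg _)
          (norm_nonneg _)
    _ = n * ‖σ‖ * b := by simp [mul_assoc]

lemma comb_abs (N n : ℕ) (R : ℝ) (hR : 0 ≤ R) (σ : EuclideanSpace ℝ (Fin n)) (x : RN N) :
    |comb N n R σ x| ≤ R * n * ‖σ‖ := by
  unfold comb
  rw [abs_mul, abs_of_nonneg hR]
  have := sum_bound n σ (fun i => bmp N i x) 1 (fun i => bmp_abs N i x)
  calc _ ≤ R * (n * ‖σ‖ * 1) := mul_le_mul_of_nonneg_left this hR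
    _ = _ := by ring

lemma comb_lip (N n : ℕ) (R : ℝ) (hR : 0 ≤ R) (σ : EuclideanSpace ℝ (Fin n)) (x y : RN N) :
    |comb N n R σ x - comb N n R σ y| ≤ R * n * ‖σ‖ * ‖x - y‖ := by
  unfold comb
  rw [← mul_sub, abs_mul, abs_of_nonneg hR, ← Finset.sum_sub_distrib]
  simp_rw [← mul_sub]
  have := sum_bound n σ (fun i => bmp N i x - bmp N i y) ‖x - y‖ (fun i => bmp_lip N i x y)
  calc _ ≤ R * (n * ‖σ‖ * ‖x - y‖) := mul_le_mul_of_nonneg_left this hR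
    _ = _ := by ring

lemma comb_supp (N n : ℕ) (R : ℝ) (σ : EuclideanSpace ℝ (Fin n)) (x : RN N)
    (hx : 3 * (n : ℝ) + 3 < ‖x‖) : comb N n R σ x = 0 := by
  unfold comb
  rw [Finset.sum_eq_zero, mul_zero]
  intro i _
  have : ((i : ℕ) : ℝ) ≤ n := by exact_mod_cast i.2.le
  rw [bmp_zero, mul_zero]
  refine le_trans ?_ (le_abs_self _)
  linarith

lemma comb_peak (N n : ℕ) (R : ℝ) (hR : 0 ≤ R) (σ : EuclideanSpace ℝ (Fin n)) (i : Fin n)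
    (x : RN N) (hx : |‖x‖ - (3 * ((i : ℕ) : ℝ) + 2)| < 1 / 2) :
    R * |σ i| / 2 ≤ |comb N n R σ x| := by
  have hs : ∑ j : Fin n, σ j * bmp N j x = σ i * bmp N i x := by
    refine Finset.sum_eq_single i ?_ (by simp)
    intro j _ hj
    rw [bmp_zero, mul_zero]
    have hx' := abs_lt.1 hx
    have hne : (j : ℕ) ≠ i := fun h => hj (Fin.ext h)
    rcases lt_or_gt_of_ne hne with h | h
    · have : ((j : ℕ) : ℝ) + 1 ≤ (i : ℕ) := by exact_mod_cast h
      refine le_trans ?_ (le_abs_self _); linarith [hx'.1]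
    · have : ((i : ℕ) : ℝ) + 1 ≤ (j : ℕ) := by exact_mod_cast h
      refine le_trans ?_ (neg_le_abs _); linarith [hx'.2]
  have hb : 1 / 2 ≤ bmp N i x := le_max_of_le_right (by linarith)
  unfold comb
  rw [hs, abs_mul, abs_mul, abs_of_nonneg hR, abs_of_nonneg (show 0 ≤ bmp N i x by linarith),
    mul_div_assoc]
  refine mul_le_mul_of_nonneg_left ?_ hR
  nlinarith [abs_nonneg (σ i)]

lemma exists_big (n : ℕ) (σ : EuclideanSpace ℝ (Fin n)) (h : ‖σ‖ = 1) :
    ∃ i, 1 ≤ n * |σ i| := by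
  by_contra! hc
  have h1 : ∑ i : Fin n, σ i ^ 2 = 1 := by
    have := EuclideanSpace.real_norm_sq_eq σ
    rw [h] at this; linarith
  have hn : n ≠ 0 := by
    rintro rfl
    simp at h1
  have hn1 : (1 : ℝ) ≤ n := by exact_mod_cast Nat.one_le_iff_ne_zero.2 hn
  have : ∑ i : Fin n, σ i ^ 2 < ∑ i : Fin n, (1 / (n : ℝ)) := by
    refine Finset.sum_lt_sum_of_nonempty ⟨⟨0, by omega⟩, by simp⟩ fun i _ => ?_
    rw [lt_div_iff₀ (by linarith), ← sq_abs]
    have := hc i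
    nlinarith [abs_nonneg (σ i)]
  rw [h1] at this
  simp [hn] at this

theorem exists_odd_map_sphere_F_ge_one (N : ℕ) (s p : ℝ) (f : ℝ → ℝ)
    (hN : 2 ≤ N) (hs : s ∈ Set.Ioo (0:ℝ) 1) (hp : 2 ≤ p)
    (hsp : s * p ≤ N)
    (hfc : Continuous f) (hodd : ∀ t : ℝ, f (-t) = -f t)
    (hf1 : hypF1 p f) (hf3 : hypF3 p f)
    (hf2 : s * p < N → hypF2 N s p f)
    (hf4 : s * p = N → ∃ α₀ > (0:ℝ), hypF4 N s f α₀) :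
    ∀ n : ℕ, ∃ piMap : EuclideanSpace ℝ (Fin n) → RN N → ℝ,
      (∀ σ : EuclideanSpace ℝ (Fin n), ‖σ‖ = 1 → memWr N s p (piMap σ)) ∧
      (∀ σ : EuclideanSpace ℝ (Fin n), ‖σ‖ = 1 → piMap (-σ) = -(piMap σ)) ∧
      (∀ σ : EuclideanSpace ℝ (Fin n), ‖σ‖ = 1 → ∀ ε > (0:ℝ), ∃ δ > (0:ℝ),
        ∀ σ' : EuclideanSpace ℝ (Fin n), ‖σ'‖ = 1 → ‖σ - σ'‖ < δ →
          sobNorm N s p (piMap σ - piMap σ') < ε) ∧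
      (∀ σ : EuclideanSpace ℝ (Fin n), ‖σ‖ = 1 → piMap σ ≠ 0) ∧
      (∀ σ : EuclideanSpace ℝ (Fin n), ‖σ‖ = 1 →
        1 ≤ ∫ x : RN N, primF f (piMap σ x)) := by
  intro n
  obtain ⟨μ, hμ, q, hpq, hlow⟩ := hf3
  have hq : 2 < q := by linarith
  have hFlow := primF_lower f hfc hodd μ q hq hlow
  have hFc : Continuous (primF f) :=
    intervalIntegral.continuous_primitive (fun a b => hfc.intervalIntegrable a b) 0
  have hF0 : primF f 0 = 0 := intervalIntegral.integral_same
  obtain ⟨C, hC, hbd⟩ := memW_and_bound N s p hN hs hp (3 * (n : ℝ) + 3)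
  set v : ℝ := (volume (Metric.ball (0 : RN N) (1 / 2))).toReal with hv
  have hv0 : 0 < v := ENNReal.toReal_pos (Metric.measure_ball_pos _ _ (by norm_num)).ne'
    measure_ball_lt_top.ne
  obtain ⟨T, hT0, hT⟩ : ∃ T : ℝ, 0 < T ∧ 1 ≤ μ / q * T ^ q * v := by
    refine ⟨(q / (μ * v)) ^ (1 / q), by positivity, le_of_eq ?_⟩
    rw [← Real.rpow_mul (by positivity), one_div_mul_cancel (by linarith), Real.rpow_one]
    field_simp
  set R : ℝ := 2 * n * T with hRdef
  have hR : 0 ≤ R := by positivity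
  have hall : ∀ σ : EuclideanSpace ℝ (Fin n), memW N s p (comb N n R σ) ∧
      sobNormP N s p (comb N n R σ) ≤ C * (R * n * ‖σ‖) ^ p := fun σ =>
    hbd _ _ (by positivity) (comb_abs N n R hR σ) (comb_lip N n R hR σ) (comb_supp N n R σ)
  have hF : ∀ σ : EuclideanSpace ℝ (Fin n), ‖σ‖ = 1 →
      1 ≤ ∫ x : RN N, primF f (comb N n R σ x) := by
    intro σ hσ
    obtain ⟨i, hi⟩ := exists_big n σ hσ
    have hcc : Continuous (comb N n R σ) := by
      unfold comb bmp; fun_prop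
    have hint : Integrable (fun x => primF f (comb N n R σ x)) := by
      refine (hFc.comp hcc).integrable_of_hasCompactSupport ?_
      refine HasCompactSupport.intro (isCompact_closedBall (0 : RN N) (3 * (n : ℝ) + 3)) ?_
      intro x hx
      simp only [Function.comp]
      rw [comb_supp N n R σ x (by simpa using hx), hF0]
    have hnn : ∀ x, 0 ≤ primF f (comb N n R σ x) := fun x =>
      le_trans (by positivity) (hFlow _)
    let c : RN N := (3 * ((i : ℕ) : ℝ) + 2) • EuclideanSpace.single (⟨0, by omega⟩ : Fin N) (1:ℝ)
    have hcn : ‖c‖ = 3 * ((i : ℕ) : ℝ) + 2 := by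
      simp only [c, norm_smul, EuclideanSpace.norm_single, norm_one, mul_one]
      exact abs_of_nonneg (by positivity)
    have hvol : (volume (Metric.ball c (1 / 2))).toReal = v := by
      rw [hv, Measure.addHaar_ball_center]
    have hpt : ∀ x ∈ Metric.ball c (1 / 2), μ / q * T ^ q ≤ primF f (comb N n R σ x) := by
      intro x hx
      refine le_trans ?_ (hFlow _)
      refine mul_le_mul_of_nonneg_left ?_ (by positivity)
      refine Real.rpow_le_rpow hT0.le ?_ (by linarith)
      refine le_trans ?_ (comb_peak N n R hR σ i x ?_)
      · rw [hRdef]; nlinarith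
      · rw [← hcn]
        refine (abs_norm_sub_norm_le x c).trans_lt ?_
        simpa [dist_eq_norm] using hx
    calc (1:ℝ) ≤ μ / q * T ^ q * v := hT
      _ = ∫ x in Metric.ball c (1 / 2), μ / q * T ^ q := by
          rw [setIntegral_const, smul_eq_mul, Measure.real, hvol, mul_comm]
      _ ≤ ∫ x in Metric.ball c (1 / 2), primF f (comb N n R σ x) :=
          setIntegral_mono_on (integrableOn_const measure_ball_lt_top.ne) hint.integrableOn
            measurableSet_ball hpt
      _ ≤ ∫ x : RN N, primF f (comb N n R σ x) :=
          setIntegral_le_integral hint (ae_of_all _ hnn)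
  refine ⟨comb N n R, fun σ _ => ⟨(hall σ).1, ?_⟩, fun σ _ => ?_, ?_, ?_, hF⟩
  · intro x y hxy
    simp only [comb, bmp, hxy]
  · funext x
    simp [comb, Finset.sum_neg_distrib]
  · intro σ _ ε hε
    set D : ℝ := C ^ (1 / p) * (R * n) with hD
    have hD0 : 0 ≤ D := by positivity
    refine ⟨ε / (D + 1), by positivity, fun σ' _ hd => ?_⟩
    rw [comb_sub]
    have h1 := (hall (σ - σ')).2
    have h0 : 0 ≤ sobNormP N s p (comb N n R (σ - σ')) := by
      unfold sobNormP gagP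
      have : 0 ≤ ∫ x : RN N, |comb N n R (σ - σ') x| ^ p :=
        integral_nonneg fun x => by positivity
      positivity
    have h2 : sobNorm N s p (comb N n R (σ - σ')) ≤ D * ‖σ - σ'‖ := by
      unfold sobNorm
      refine (Real.rpow_le_rpow h0 h1 (by positivity)).trans_eq ?_
      rw [Real.mul_rpow hC (by positivity), ← Real.rpow_mul (by positivity),
        mul_one_div_cancel (by linarith), Real.rpow_one, hD]
      ring
    rw [lt_div_iff₀ (by linarith)] at hd
    nlinarith [norm_nonneg (σ - σ')]
  · intro σ hσ h0
    have := hF σ hσ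
    rw [h0] at this
    simp [hF0] at this
    linarith
end
end

section
/- Let s ∈ (0,1), p ∈ [2,∞), N ≥ 2 an integer with sp = N, and let f : ℝ → ℝ be an odd continuous function satisfying (f1), (f3) and (f4). Then there exist β > 0 and ρ > 0 such that I(u) ≥ β for every u ∈ W_r^{s,p}(ℝ^N) with ‖u‖_{s,p} = ρ, and I(u) ≥ 0 for every u ∈ W_r^{s,p}(ℝ^N) with ‖u‖_{s,p} ≤ ρ. -/
open MeasureTheory Real Filter Topology Set

noncomputable section

lemma aux_jensen {X : Type*} [MeasurableSpace X] (μ : Measure X) (S : Set X) (p : ℝ) (hp : 1 ≤ p)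
    (h0 : μ S ≠ 0) (ht : μ S ≠ ⊤) (u : X → ℝ) (hu : IntegrableOn u S μ) (c : ℝ) :
    ‖(⨍ y in S, u y ∂μ) - c‖ₑ ^ p ≤ (μ S)⁻¹ * ∫⁻ y in S, ‖u y - c‖ₑ ^ p ∂μ := by
  set ν : Measure X := (μ S)⁻¹ • μ.restrict S with hν
  have hprob : IsProbabilityMeasure ν := by
    constructor
    simp [hν, ENNReal.inv_mul_cancel h0 ht]
  have hav : (⨍ y in S, u y ∂μ) = ∫ y, u y ∂ν := by
    simp [average, hν]
  have hint : Integrable u ν := hu.smul_measure (by simp [h0])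
  have h1 : (⨍ y in S, u y ∂μ) - c = ∫ y, (u y - c) ∂ν := by
    rw [integral_sub hint (integrable_const c), hav]; simp
  have h2 : ‖(⨍ y in S, u y ∂μ) - c‖ₑ ≤ ∫⁻ y, ‖u y - c‖ₑ ∂ν := by
    rw [h1]; exact enorm_integral_le_lintegral_enorm _
  have h3 : (∫⁻ y, ‖u y - c‖ₑ ∂ν) ≤ (∫⁻ y, ‖u y - c‖ₑ ^ p ∂ν) ^ (1 / p) := by
    have := eLpNorm_le_eLpNorm_of_exponent_le (p := 1) (q := ENNReal.ofReal p) (μ := ν)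
      (f := fun y => u y - c) (by simpa using hp) (hint.sub (integrable_const c)).aestronglyMeasurable
    rw [eLpNorm_one_eq_lintegral_enorm, eLpNorm_eq_lintegral_rpow_enorm_toReal
      (by simp; linarith) (by simp), ENNReal.toReal_ofReal (by linarith)] at this
    exact this
  have h4 : (∫⁻ y, ‖u y - c‖ₑ ^ p ∂ν) = (μ S)⁻¹ * ∫⁻ y in S, ‖u y - c‖ₑ ^ p ∂μ := by
    rw [hν, lintegral_smul_measure]; rfl
  rw [← h4]
  calc _ ≤ ((∫⁻ y, ‖u y - c‖ₑ ^ p ∂ν) ^ (1 / p)) ^ p := by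
        gcongr; exact h2.trans h3
    _ = _ := by
        rw [← ENNReal.rpow_mul, one_div, inv_mul_cancel₀ (by linarith), ENNReal.rpow_one]

/-- annuli -/
def ann (N : ℕ) (k : ℕ) (x : RN N) : Set (RN N) :=
  Metric.ball x ((1/2:ℝ) ^ k) \ Metric.ball x ((1/2:ℝ) ^ (k+1))

lemma ann_meas (N k : ℕ) (x : RN N) : MeasurableSet (ann N k x) :=
  measurableSet_ball.diff measurableSet_ball

lemma ann_disj (N : ℕ) (x : RN N) : Pairwise (Function.onFun Disjoint (fun k => ann N k x)) := by
  have key : ∀ i j : ℕ, i < j → Disjoint (ann N i x) (ann N j x) := by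
    intro i j hij
    rw [Set.disjoint_left]
    rintro y ⟨_, h2⟩ ⟨h3, _⟩
    apply h2
    refine Metric.ball_subset_ball ?_ h3
    exact pow_le_pow_of_le_one (by norm_num) (by norm_num) hij
  intro i j hij
  rcases lt_or_gt_of_ne hij with h | h
  · exact key i j h
  · exact (key j i h).symm

lemma ann_vol (N : ℕ) (hN : 2 ≤ N) : ∃ κ > (0:ℝ), ∀ (k : ℕ) (x : RN N),
    volume (ann N k x) = ENNReal.ofReal (κ * (1/2:ℝ) ^ (k * N)) := by
  have hb0 : volume (Metric.ball (0 : RN N) 1) ≠ 0 := (Metric.measure_ball_pos _ _ one_pos).ne'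
  have hbt : volume (Metric.ball (0 : RN N) 1) ≠ ⊤ := measure_ball_lt_top.ne
  set b : ℝ := (volume (Metric.ball (0 : RN N) 1)).toReal with hb
  have hbpos : 0 < b := ENNReal.toReal_pos hb0 hbt
  have hbb : volume (Metric.ball (0 : RN N) 1) = ENNReal.ofReal b := (ENNReal.ofReal_toReal hbt).symm
  have hv : ∀ (k : ℕ) (x : RN N), volume (Metric.ball x ((1/2:ℝ)^k)) =
      ENNReal.ofReal (b * (1/2:ℝ) ^ (k * N)) := by
    intro k x
    rw [Measure.addHaar_ball_of_pos _ _ (by positivity), hbb, ← ENNReal.ofReal_mul (by positivity)]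
    simp only [finrank_euclideanSpace, Fintype.card_fin]
    rw [← pow_mul, mul_comm]
  have h1 : (1/2:ℝ) ^ N < 1 := pow_lt_one₀ (by norm_num) (by norm_num) (by omega)
  refine ⟨b * (1 - (1/2:ℝ)^N), mul_pos hbpos (by linarith), fun k x => ?_⟩
  rw [ann, measure_sdiff (Metric.ball_subset_ball
    (pow_le_pow_of_le_one (by norm_num) (by norm_num) (Nat.le_succ k)))
    measurableSet_ball.nullMeasurableSet measure_ball_lt_top.ne, hv, hv,
    ← ENNReal.ofReal_sub _ (by positivity)]
  congr 1
  rw [Nat.succ_mul, pow_add]; ring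

/-- kernel -/
def kE (N : ℕ) (s p : ℝ) (u : RN N → ℝ) (x y : RN N) : ENNReal :=
  ENNReal.ofReal (|u x - u y| ^ p / ‖x - y‖ ^ ((N : ℝ) + s * p))

/-- inner integral -/
def gE (N : ℕ) (s p : ℝ) (u : RN N → ℝ) (x : RN N) : ENNReal := ∫⁻ y, kE N s p u x y

lemma gagE_eq (N : ℕ) (s p : ℝ) (u : RN N → ℝ) : gagE N s p u = ∫⁻ x, gE N s p u x := rfl

lemma kE_lower (N : ℕ) (s p : ℝ) (u : RN N → ℝ) (hp : 2 ≤ p) (hsp : s * p = N) (R : ℝ)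
    (y z : RN N) (h : ‖y - z‖ ≤ R) :
    ‖u z - u y‖ₑ ^ p ≤ ENNReal.ofReal (R ^ (2 * N)) * kE N s p u y z := by
  have hR : 0 ≤ R := (norm_nonneg _).trans h
  have e1 : ‖u z - u y‖ₑ ^ p = ENNReal.ofReal (|u y - u z| ^ p) := by
    rw [Real.enorm_eq_ofReal_abs, ENNReal.ofReal_rpow_of_nonneg (abs_nonneg _) (by linarith),
      abs_sub_comm]
  rw [e1, kE, ← ENNReal.ofReal_mul (by positivity)]
  apply ENNReal.ofReal_le_ofReal
  rcases eq_or_ne y z with rfl | hyz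
  · simp [Real.zero_rpow (by linarith : p ≠ 0)]
  · have hpos : 0 < ‖y - z‖ := norm_pos_iff.2 (sub_ne_zero.2 hyz)
    have e2 : ‖y - z‖ ^ ((N:ℝ) + s * p) = ‖y - z‖ ^ (2 * N) := by
      rw [hsp, ← Real.rpow_natCast]; congr 1; push_cast; ring
    rw [e2]
    have h3 : ‖y - z‖ ^ (2 * N) ≤ R ^ (2 * N) := by gcongr
    have h4 : 0 < ‖y - z‖ ^ (2 * N) := by positivity
    have h5 : 0 ≤ |u y - u z| ^ p := by positivity
    rw [mul_div_assoc', le_div_iff₀ h4, mul_comm]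
    gcongr

/-- annular average -/
def av (N : ℕ) (u : RN N → ℝ) (k : ℕ) (x : RN N) : ℝ := ⨍ y in ann N k x, u y

lemma ann_dist {N k : ℕ} {x y : RN N} (h : y ∈ ann N k x) : ‖y - x‖ ≤ (1/2:ℝ)^k := by
  have := h.1
  rw [mem_ball_iff_norm] at this
  exact this.le

section
variable {N : ℕ} {s p : ℝ} {u : RN N → ℝ} {κ : ℝ}

lemma osc (hp : 2 ≤ p) (hsp : s * p = N) (hκ : 0 < κ)
    (hvol : ∀ (k : ℕ) (x : RN N), volume (ann N k x) = ENNReal.ofReal (κ * (1/2:ℝ) ^ (k * N)))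
    (hloc : ∀ k x, IntegrableOn u (ann N k x)) (n : ℕ) (x y : RN N) (R : ℝ)
    (hR : ∀ z ∈ ann N n x, ‖y - z‖ ≤ R) :
    ‖av N u n x - u y‖ₑ ^ p ≤
      ENNReal.ofReal ((κ * (1/2:ℝ) ^ (n * N))⁻¹ * R ^ (2 * N)) * gE N s p u y := by
  have hpos : 0 < κ * (1/2:ℝ) ^ (n * N) := by positivity
  refine (aux_jensen volume (ann N n x) p (by linarith) (by rw [hvol]; simpa using hpos)
    (by rw [hvol]; simp) u (hloc n x) (u y)).trans ?_
  rw [ENNReal.ofReal_mul (by positivity), mul_assoc, hvol, ENNReal.ofReal_inv_of_pos hpos]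
  gcongr
  calc ∫⁻ z in ann N n x, ‖u z - u y‖ₑ ^ p
      ≤ ∫⁻ z in ann N n x, ENNReal.ofReal (R ^ (2 * N)) * kE N s p u y z :=
        setLIntegral_mono' (ann_meas N n x) fun z hz => kE_lower N s p u hp hsp R y z (hR z hz)
    _ = ENNReal.ofReal (R ^ (2 * N)) * ∫⁻ z in ann N n x, kE N s p u y z :=
        lintegral_const_mul' _ _ (by simp)
    _ ≤ _ := by gcongr; exact setLIntegral_le_lintegral _ _

lemma osc1 (hp : 2 ≤ p) (hsp : s * p = N) (hκ : 0 < κ)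
    (hvol : ∀ (k : ℕ) (x : RN N), volume (ann N k x) = ENNReal.ofReal (κ * (1/2:ℝ) ^ (k * N)))
    (hloc : ∀ k x, IntegrableOn u (ann N k x)) (n : ℕ) (x : RN N) :
    ‖av N u n x - u x‖ₑ ^ p ≤ ENNReal.ofReal (κ⁻¹ * (1/2:ℝ) ^ (n * N)) * gE N s p u x := by
  have := osc hp hsp hκ hvol hloc n x x ((1/2:ℝ)^n)
    (fun z hz => by rw [norm_sub_rev]; exact ann_dist hz)
  convert this using 3
  have e : ((1/2:ℝ)^n)^(2*N) = (1/2:ℝ)^(n*N) * (1/2:ℝ)^(n*N) := by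
    rw [← pow_mul, ← pow_add]; congr 1; ring
  rw [e]
  have : (0:ℝ) < (1/2:ℝ)^(n*N) := by positivity
  field_simp

lemma osc2 (hp : 2 ≤ p) (hsp : s * p = N) (hκ : 0 < κ)
    (hvol : ∀ (k : ℕ) (x : RN N), volume (ann N k x) = ENNReal.ofReal (κ * (1/2:ℝ) ^ (k * N)))
    (hloc : ∀ k x, IntegrableOn u (ann N k x)) (n : ℕ) (x : RN N) :
    ‖av N u n x - av N u (n+1) x‖ₑ ^ p ≤
      ENNReal.ofReal (κ⁻¹ ^ 2 * 2 ^ (3 * N)) * ∫⁻ y in ann N n x, gE N s p u y := by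
  have hpos : 0 < κ * (1/2:ℝ) ^ (n * N) := by positivity
  refine (aux_jensen volume (ann N n x) p (by linarith) (by rw [hvol]; simpa using hpos)
    (by rw [hvol]; simp) u (hloc n x) (av N u (n+1) x)).trans ?_
  have h1 : ∀ y ∈ ann N n x, ‖u y - av N u (n+1) x‖ₑ ^ p ≤
      ENNReal.ofReal ((κ * (1/2:ℝ) ^ ((n+1) * N))⁻¹ * (2 * (1/2:ℝ)^n) ^ (2 * N)) * gE N s p u y := by
    intro y hy
    rw [← enorm_neg, neg_sub]
    refine osc hp hsp hκ hvol hloc (n+1) x y _ (fun z hz => ?_)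
    have a1 := ann_dist hy
    have a2 := ann_dist hz
    rw [norm_sub_rev] at a2
    have a3 : (1/2:ℝ)^(n+1) ≤ (1/2:ℝ)^n :=
      pow_le_pow_of_le_one (by norm_num) (by norm_num) (Nat.le_succ n)
    have a4 := norm_add_le (y - x) (x - z)
    rw [sub_add_sub_cancel] at a4
    linarith
  calc _ ≤ (volume (ann N n x))⁻¹ * ∫⁻ y in ann N n x, ENNReal.ofReal
        ((κ * (1/2:ℝ) ^ ((n+1) * N))⁻¹ * (2 * (1/2:ℝ)^n) ^ (2 * N)) * gE N s p u y := by
        exact mul_le_mul_right (setLIntegral_mono' (ann_meas N n x) h1) _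
    _ = _ := by
        rw [lintegral_const_mul' _ _ (by simp), ← mul_assoc, hvol,
          ← ENNReal.ofReal_inv_of_pos hpos, ← ENNReal.ofReal_mul (by positivity)]
        congr 2
        have e : ((2:ℝ) * (1/2:ℝ)^n)^(2*N) = 2^(2*N) * ((1/2:ℝ)^(n*N) * (1/2:ℝ)^(n*N)) := by
          rw [mul_pow, ← pow_mul, ← pow_add]; congr 2; ring
        have e2 : (1/2:ℝ) ^ ((n+1) * N) = (1/2:ℝ)^(n*N) * (2^N)⁻¹ := by
          rw [add_mul, pow_add, one_mul]; congr 1; simp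
        have e3 : (2:ℝ)^(3*N) = 2^(2*N) * 2^N := by rw [← pow_add]; congr 1; ring
        rw [e, e2, e3]
        have : (0:ℝ) < (1/2:ℝ)^(n*N) := by positivity
        field_simp

lemma av_bound (hp : 2 ≤ p) (hsp : s * p = N) (hκ : 0 < κ)
    (hvol : ∀ (k : ℕ) (x : RN N), volume (ann N k x) = ENNReal.ofReal (κ * (1/2:ℝ) ^ (k * N)))
    (hloc : ∀ k x, IntegrableOn u (ann N k x)) (n : ℕ) (x : RN N) :
    ‖av N u n x‖ₑ ^ p ≤ ((n + 1 : ℕ) : ENNReal) ^ (p - 1) *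
      (ENNReal.ofReal (κ⁻¹) * (∫⁻ y, ‖u y‖ₑ ^ p) +
        ENNReal.ofReal (κ⁻¹ ^ 2 * 2 ^ (3 * N)) * gagE N s p u) := by
  set b : ℕ → ENNReal := fun j => match j with
    | 0 => ‖av N u 0 x‖ₑ
    | j+1 => ‖av N u j x - av N u (j+1) x‖ₑ with hb
  have h1 : ∀ n, ‖av N u n x‖ₑ ≤ ∑ j ∈ Finset.range (n+1), b j := by
    intro n
    induction n with
    | zero => simp [hb]
    | succ n ih =>
      rw [Finset.sum_range_succ]
      calc ‖av N u (n+1) x‖ₑ = ‖av N u n x - (av N u n x - av N u (n+1) x)‖ₑ := by congr 1; ring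
        _ ≤ ‖av N u n x‖ₑ + ‖av N u n x - av N u (n+1) x‖ₑ := enorm_sub_le
        _ ≤ _ := by gcongr
  have h2 := ENNReal.rpow_sum_le_const_mul_sum_rpow (Finset.range (n+1)) b (p := p) (by linarith)
  rw [Finset.card_range] at h2
  refine (ENNReal.rpow_le_rpow (h1 n) (by linarith)).trans (h2.trans ?_)
  gcongr
  rw [Finset.sum_range_succ', add_comm]
  gcongr
  · have := aux_jensen volume (ann N 0 x) p (by linarith) (by rw [hvol]; simpa using hκ)
      (by rw [hvol]; simp) u (hloc 0 x) 0
    simp only [sub_zero, hvol, zero_mul, pow_zero, mul_one] at this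
    rw [ENNReal.ofReal_inv_of_pos hκ]
    refine this.trans ?_
    exact mul_le_mul_right (setLIntegral_le_lintegral _ _) _
  · calc ∑ j ∈ Finset.range n, b (j+1) ^ p
        ≤ ∑ j ∈ Finset.range n, ENNReal.ofReal (κ⁻¹ ^ 2 * 2 ^ (3 * N)) *
          ∫⁻ y in ann N j x, gE N s p u y :=
          Finset.sum_le_sum fun j _ => osc2 hp hsp hκ hvol hloc j x
      _ = ENNReal.ofReal (κ⁻¹ ^ 2 * 2 ^ (3 * N)) * ∑ j ∈ Finset.range n,
          ∫⁻ y in ann N j x, gE N s p u y := by rw [Finset.mul_sum]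
      _ ≤ _ := by
          gcongr
          refine (ENNReal.sum_le_tsum _).trans ?_
          rw [← lintegral_iUnion (fun j => ann_meas N j x) (ann_disj N x), gagE_eq]
          exact setLIntegral_le_lintegral _ _
end

section
variable {N : ℕ} {s p : ℝ} {u : RN N → ℝ} {κ : ℝ}

lemma core_ptwise (hN : 2 ≤ N) (hp : 2 ≤ p) (hsp : s * p = N) (hκ : 0 < κ)
    (hvol : ∀ (k : ℕ) (x : RN N), volume (ann N k x) = ENNReal.ofReal (κ * (1/2:ℝ) ^ (k * N)))
    (hloc : ∀ k x, IntegrableOn u (ann N k x)) (Q T α δ : ℝ) (n0 : ℕ) (hQ0 : 0 ≤ Q)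
    (hQ : ENNReal.ofReal (κ⁻¹) * (∫⁻ y, ‖u y‖ₑ ^ p) +
        ENNReal.ofReal (κ⁻¹ ^ 2 * 2 ^ (3 * N)) * gagE N s p u ≤ ENNReal.ofReal Q)
    (hT : 0 < T) (hTQ : T ^ (p - 1) * Q ≤ (1/2:ℝ) ^ p) (hα : α ≤ T * Real.log 2)
    (hδ : 0 < δ) (hδT : (n0:ℝ) + 1 ≤ T * δ ^ (p / (p-1))) (x : RN N) (hx : δ ≤ |u x|) :
    ENNReal.ofReal (|u x| ^ p * Real.exp (α * |u x| ^ (p / (p-1)))) ≤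
      ENNReal.ofReal (2 ^ p * 4 * κ⁻¹ * (1/2:ℝ) ^ n0) * gE N s p u x := by
  set t := |u x| with ht
  have ht0 : 0 < t := hδ.trans_le hx
  set τ := T * t ^ (p / (p-1)) with hτ
  have hτ1 : (n0:ℝ) + 1 ≤ τ := hδT.trans (by
    rw [hτ]; gcongr
    exact div_nonneg (by linarith) (by linarith))
  have hτ0 : 0 ≤ τ := by positivity
  obtain ⟨n, hn⟩ : ∃ n : ℕ, ⌊τ⌋₊ = n0 + 1 + n :=
    Nat.exists_eq_add_of_le (Nat.le_floor (by push_cast; exact hτ1))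
  have hn1 : (n0:ℝ) + n + 1 ≤ τ := by
    have := Nat.floor_le hτ0
    rw [hn] at this; push_cast at this; linarith
  have hn2 : τ ≤ (n0:ℝ) + n + 2 := by
    have := Nat.lt_floor_add_one τ
    rw [hn] at this; push_cast at this; linarith
  set m := n0 + n with hm
  have hτp : τ ^ (p-1) = T ^ (p-1) * t ^ p := by
    rw [hτ, Real.mul_rpow hT.le (by positivity), ← Real.rpow_mul ht0.le]
    congr 2; rw [div_mul_cancel₀]; linarith
  have hav : |av N u m x| ≤ t / 2 := by
    have h := (av_bound (s := s) hp hsp hκ hvol hloc m x).trans (mul_le_mul_right hQ _)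
    rw [Real.enorm_eq_ofReal_abs, ENNReal.ofReal_rpow_of_nonneg (abs_nonneg _) (by linarith),
      ← ENNReal.ofReal_natCast, ENNReal.ofReal_rpow_of_nonneg (by positivity) (by linarith),
      ← ENNReal.ofReal_mul (by positivity), ENNReal.ofReal_le_ofReal_iff (by positivity)] at h
    have h2 : |av N u m x| ^ p ≤ (t/2) ^ p := by
      calc _ ≤ _ := h
        _ ≤ τ ^ (p-1) * Q := by
            gcongr
            · linarith
            · rw [hm]; push_cast; linarith
        _ = (T ^ (p-1) * Q) * t ^ p := by rw [hτp]; ring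
        _ ≤ (1/2:ℝ)^p * t ^ p := by gcongr
        _ = _ := by rw [← Real.mul_rpow (by norm_num) ht0.le]; congr 1; ring
    exact (Real.rpow_le_rpow_iff (abs_nonneg _) (by positivity) (by linarith)).1 h2
  have hdiff : t / 2 ≤ |av N u m x - u x| := by
    have h1 := abs_sub_abs_le_abs_sub (u x) (av N u m x)
    rw [abs_sub_comm] at h1
    linarith
  have hosc := osc1 hp hsp hκ hvol hloc m x
  have h3 : ENNReal.ofReal ((t/2)^p) ≤
      ENNReal.ofReal (κ⁻¹ * (1/2:ℝ) ^ (m * N)) * gE N s p u x := by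
    refine le_trans ?_ hosc
    rw [Real.enorm_eq_ofReal_abs, ENNReal.ofReal_rpow_of_nonneg (abs_nonneg _) (by linarith)]
    apply ENNReal.ofReal_le_ofReal
    gcongr
  have hexp : Real.exp (α * t ^ (p / (p-1))) ≤ 2 ^ (m + 2) := by
    calc _ ≤ Real.exp (Real.log 2 * ((m + 2 : ℕ) : ℝ)) := by
          apply Real.exp_le_exp.2
          have l2 : 0 < Real.log 2 := Real.log_pos (by norm_num)
          have a1 : α * t ^ (p / (p-1)) ≤ (T * Real.log 2) * t ^ (p / (p-1)) := by gcongr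
          have a2 : (T * Real.log 2) * t ^ (p / (p-1)) = Real.log 2 * τ := by rw [hτ]; ring
          have a3 : Real.log 2 * τ ≤ Real.log 2 * ((m + 2 : ℕ) : ℝ) := by
            gcongr; rw [hm]; push_cast; linarith
          linarith
      _ = _ := by
          rw [← Real.rpow_def_of_pos (by norm_num), Real.rpow_natCast]
  have hhalf : (1/2:ℝ) ^ (m * N) ≤ (1/2:ℝ) ^ (m + m) :=
    pow_le_pow_of_le_one (by norm_num) (by norm_num) (by nlinarith)
  have hh2 : (2:ℝ) ^ (m+2) * (1/2:ℝ) ^ (m + m) ≤ 4 * (1/2:ℝ) ^ n0 := by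
    have : (2:ℝ) ^ (m+2) * (1/2:ℝ) ^ (m + m) = 4 * (1/2:ℝ)^m := by
      have e : (2:ℝ)^m * (1/2:ℝ)^m = 1 := by rw [← mul_pow]; norm_num
      rw [pow_add, pow_add]
      linear_combination (4 * (1/2:ℝ)^m) * e
    rw [this]
    have := pow_le_pow_of_le_one (a := (1/2:ℝ)) (by norm_num) (by norm_num) (show n0 ≤ m by omega)
    linarith
  calc ENNReal.ofReal (t ^ p * Real.exp (α * t ^ (p / (p-1))))
      = ENNReal.ofReal (2 ^ p * Real.exp (α * t ^ (p / (p-1)))) * ENNReal.ofReal ((t/2)^p) := by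
        rw [← ENNReal.ofReal_mul (by positivity)]
        congr 1
        rw [Real.div_rpow ht0.le (by norm_num)]
        field_simp
    _ ≤ ENNReal.ofReal (2 ^ p * 2 ^ (m+2)) *
        (ENNReal.ofReal (κ⁻¹ * (1/2:ℝ) ^ (m + m)) * gE N s p u x) := by
        refine mul_le_mul' (ENNReal.ofReal_le_ofReal (by gcongr)) (h3.trans ?_)
        refine mul_le_mul' (ENNReal.ofReal_le_ofReal ?_) le_rfl
        gcongr κ⁻¹ * ?_
    _ ≤ _ := by
        rw [← mul_assoc, ← ENNReal.ofReal_mul (by positivity)]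
        refine mul_le_mul' (ENNReal.ofReal_le_ofReal ?_) le_rfl
        calc _ = 2 ^ p * κ⁻¹ * ((2:ℝ) ^ (m+2) * (1/2:ℝ) ^ (m + m)) := by ring
          _ ≤ 2 ^ p * κ⁻¹ * (4 * (1/2:ℝ) ^ n0) := by gcongr
          _ = _ := by ring
end

lemma primF_abs (f : ℝ → ℝ) (hodd : ∀ t : ℝ, f (-t) = -f t) (t : ℝ) :
    primF f t = primF f |t| := by
  have : primF f (-t) = primF f t := by
    unfold primF
    have h := intervalIntegral.integral_comp_neg (a := 0) (b := t) f
    simp only [hodd, neg_zero, intervalIntegral.integral_neg] at h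
    rw [intervalIntegral.integral_symm, ← h, neg_neg]
  rcases abs_choice t with h | h <;> rw [h]
  exact this.symm

lemma primF_le (f : ℝ → ℝ) (hfc : Continuous f) (t B : ℝ) (ht : 0 ≤ t)
    (h : ∀ τ, 0 ≤ τ → τ ≤ t → f τ ≤ B) : primF f t ≤ t * B := by
  have := intervalIntegral.integral_mono_on (μ := volume) ht (hfc.intervalIntegrable 0 t)
    (intervalIntegrable_const (c := B)) (fun τ hτ => h τ hτ.1 hτ.2)
  simpa [primF] using this

lemma exp_growth (N : ℕ) (s : ℝ) (f : ℝ → ℝ) (hfc : Continuous f) (α₀ : ℝ)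
    (hα₀ : 0 < α₀) (h : hypF4 N s f α₀) :
    ∃ C > (0:ℝ), ∀ t ≥ (0:ℝ), f t ≤ C * Real.exp ((α₀+1) * t ^ ((N : ℝ) / ((N : ℝ) - s))) := by
  have h1 := h.1 (α₀+1) (by linarith)
  have h2 : ∀ᶠ t in atTop, f t / Real.exp ((α₀+1) * t ^ ((N : ℝ) / ((N : ℝ) - s))) < 1 :=
    h1.eventually (gt_mem_nhds one_pos)
  obtain ⟨A, hA⟩ := eventually_atTop.1 h2
  obtain ⟨B, hB⟩ := (isCompact_Icc (a := (0:ℝ)) (b := A)).exists_bound_of_continuousOn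
    hfc.continuousOn
  refine ⟨max B 1, by positivity, fun t ht => ?_⟩
  have hr : 0 ≤ (α₀+1) * t ^ ((N : ℝ) / ((N : ℝ) - s)) := by positivity
  have he : 1 ≤ Real.exp ((α₀+1) * t ^ ((N : ℝ) / ((N : ℝ) - s))) := Real.one_le_exp hr
  rcases le_total t A with h3 | h3
  · have h4 := hB t ⟨ht, h3⟩
    have h5 := le_abs_self (f t)
    rw [Real.norm_eq_abs] at h4
    calc f t ≤ B := h5.trans h4
      _ ≤ max B 1 * 1 := by simp
      _ ≤ _ := by gcongr
  · have h4 := hA t h3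
    rw [div_lt_one (by positivity)] at h4
    calc f t ≤ 1 * Real.exp ((α₀+1) * t ^ ((N : ℝ) / ((N : ℝ) - s))) := by linarith
      _ ≤ _ := by gcongr; exact le_max_right _ _

lemma primF_bounds (N : ℕ) (s p : ℝ) (f : ℝ → ℝ)
    (hN : 2 ≤ N) (hs : s ∈ Set.Ioo (0:ℝ) 1) (hp : 2 ≤ p)
    (hsp : s * p = N)
    (hfc : Continuous f) (hodd : ∀ t : ℝ, f (-t) = -f t)
    (hf1 : hypF1 p f) (hf3 : hypF3 p f) (hf4 : ∃ α₀ > (0:ℝ), hypF4 N s f α₀)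
    (ε : ℝ) (hε : 0 < ε) :
    ∃ δ > (0:ℝ), ∃ K > (0:ℝ), ∃ α > (0:ℝ), ∀ t, 0 ≤ primF f t ∧
      (|t| < δ → primF f t ≤ ε * |t| ^ p) ∧
      (δ ≤ |t| → primF f t ≤ K * (|t| ^ p * Real.exp (α * |t| ^ (p / (p-1))))) := by
  obtain ⟨α₀, hα₀, hf4⟩ := hf4
  obtain ⟨C, hC, hCf⟩ := exp_growth N s f hfc α₀ hα₀ hf4
  have hexpo : (N : ℝ) / ((N : ℝ) - s) = p / (p - 1) := by
    rw [← hsp, show s * p - s = s * (p - 1) by ring, mul_div_mul_left _ _ hs.1.ne']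
  rw [hexpo] at hCf
  have hf0 : f 0 = 0 := by have := hodd 0; simp at this; linarith
  have hpos : ∀ t ≥ (0:ℝ), 0 ≤ f t := by
    obtain ⟨μ, hμ, q, _, h⟩ := hf3
    intro t ht
    exact le_trans (by positivity) (h t ht)
  have hev : ∀ᶠ t in 𝓝[≠] (0:ℝ), |f t / (|t| ^ (p - 2) * t)| < ε := by
    have := hf1.abs
    rw [abs_zero] at this
    exact this.eventually (gt_mem_nhds hε)
  rw [eventually_nhdsWithin_iff, Metric.eventually_nhds_iff] at hev
  obtain ⟨δ, hδ, hδf⟩ := hev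
  have hsmall : ∀ t, 0 ≤ t → t < δ → f t ≤ ε * t ^ (p-1) := by
    intro t ht htδ
    rcases ht.eq_or_lt with rfl | ht'
    · rw [hf0]; positivity
    · have h1 := hδf (y := t) (by simpa [abs_of_pos ht'] using htδ) ht'.ne'
      rw [abs_of_pos ht'] at h1
      have h2 : t ^ (p-2) * t = t ^ (p-1) := by
        rw [← Real.rpow_add_one ht'.ne']; congr 1; ring
      rw [h2] at h1
      have h3 := (le_abs_self _).trans h1.le
      rwa [div_le_iff₀ (by positivity)] at h3
  refine ⟨δ, hδ, C * (δ ^ (p-1))⁻¹, by positivity, α₀+1, by positivity, fun t => ?_⟩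
  rw [primF_abs f hodd t]
  have ht0 := abs_nonneg t
  set r := |t|
  refine ⟨intervalIntegral.integral_nonneg ht0 fun τ hτ => hpos τ hτ.1, fun h => ?_, fun h => ?_⟩
  · have := primF_le f hfc r (ε * r ^ (p-1)) ht0 (fun τ h1 h2 => (hsmall τ h1 (by linarith)).trans
      (by gcongr; linarith))
    refine this.trans (le_of_eq ?_)
    rcases ht0.eq_or_lt with h0 | h0
    · rw [← h0]; simp [Real.zero_rpow (by linarith : p ≠ 0)]
    · have : r ^ p = r ^ (p-1) * r := by rw [← Real.rpow_add_one h0.ne']; congr 1; ring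
      rw [this]; ring
  · have hr : 0 < r := hδ.trans_le h
    have h1 := primF_le f hfc r (C * Real.exp ((α₀+1) * r ^ (p / (p-1)))) ht0
      (fun τ h1 h2 => (hCf τ h1).trans (by
        gcongr
        exact div_nonneg (by linarith) (by linarith)))
    refine h1.trans ?_
    have e : r ^ p = r ^ (p-1) * r := by rw [← Real.rpow_add_one hr.ne']; congr 1; ring
    have h2 : 1 ≤ (δ ^ (p-1))⁻¹ * r ^ (p-1) := by
      rw [inv_mul_eq_div, one_le_div (by positivity)]
      gcongr; linarith
    rw [e]
    calc r * (C * Real.exp ((α₀+1) * r ^ (p / (p-1))))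
        = 1 * (r * (C * Real.exp ((α₀+1) * r ^ (p / (p-1))))) := by ring
      _ ≤ ((δ ^ (p-1))⁻¹ * r ^ (p-1)) * (r * (C * Real.exp ((α₀+1) * r ^ (p / (p-1))))) := by
          gcongr
      _ = _ := by ring

lemma ene_lower (N : ℕ) (s p : ℝ) (f : ℝ → ℝ)
    (hN : 2 ≤ N) (hs : s ∈ Set.Ioo (0:ℝ) 1) (hp : 2 ≤ p)
    (hsp : s * p = N)
    (hfc : Continuous f) (hodd : ∀ t : ℝ, f (-t) = -f t)
    (hf1 : hypF1 p f) (hf3 : hypF3 p f) (hf4 : ∃ α₀ > (0:ℝ), hypF4 N s f α₀) :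
    ∃ ρ > (0:ℝ), ∀ u : RN N → ℝ, memW N s p u → sobNormP N s p u ≤ ρ ^ p →
      1 / (2 * p) * sobNormP N s p u ≤ ene N s p f u := by
  have hp0 : 0 < p := by linarith
  set ε : ℝ := 1 / (4 * p) with hεd
  have hε : 0 < ε := by positivity
  obtain ⟨δ, hδ, K, hK, α, hα, hF⟩ :=
    primF_bounds N s p f hN hs hp hsp hfc hodd hf1 hf3 hf4 ε hε
  obtain ⟨κ, hκ, hvol⟩ := ann_vol N hN
  obtain ⟨n0, hn0⟩ := exists_pow_lt_of_lt_one
    (show 0 < ε / (K * (2 ^ p * 4 * κ⁻¹)) by positivity) (show (1/2:ℝ) < 1 by norm_num)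
  rw [lt_div_iff₀ (by positivity)] at hn0
  have hl2 : 0 < Real.log 2 := Real.log_pos (by norm_num)
  have hδp : 0 < δ ^ (p / (p-1)) := by positivity
  set T : ℝ := max (α / Real.log 2) (((n0:ℝ) + 1) / δ ^ (p / (p-1))) with hTd
  have hT : 0 < T := lt_max_of_lt_left (by positivity)
  have hT1 : α ≤ T * Real.log 2 := by
    rw [← div_le_iff₀ hl2]; exact le_max_left _ _
  have hT2 : (n0:ℝ) + 1 ≤ T * δ ^ (p / (p-1)) := by
    rw [← div_le_iff₀ hδp]; exact le_max_right _ _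
  set C2 : ℝ := κ⁻¹ + κ⁻¹ ^ 2 * 2 ^ (3 * N) with hC2
  have hC2pos : 0 < C2 := by positivity
  set A : ℝ := (1/2:ℝ)^p / (T ^ (p-1) * C2) with hA
  have hApos : 0 < A := by positivity
  refine ⟨A ^ (1/p), by positivity, fun u hu hnorm => ?_⟩
  have hAp : (A ^ (1/p)) ^ p = A := by
    rw [← Real.rpow_mul hApos.le, one_div, inv_mul_cancel₀ hp0.ne', Real.rpow_one]
  rw [hAp] at hnorm
  obtain ⟨hum, hui, hug⟩ := hu
  have hI0 : 0 ≤ ∫ x : RN N, |u x| ^ p := integral_nonneg fun x => by positivity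
  have hG0 : 0 ≤ gagP N s p u := ENNReal.toReal_nonneg
  have hgE : gagE N s p u = ENNReal.ofReal (gagP N s p u) := (ENNReal.ofReal_toReal hug.ne).symm
  have hLp : ∫⁻ x, ‖u x‖ₑ ^ p = ENNReal.ofReal (∫ x : RN N, |u x| ^ p) := by
    rw [ofReal_integral_eq_lintegral_ofReal hui (Eventually.of_forall fun x => by positivity)]
    refine lintegral_congr fun x => ?_
    rw [Real.enorm_eq_ofReal_abs, ENNReal.ofReal_rpow_of_nonneg (abs_nonneg _) hp0.le]
  have hloc : ∀ k x, IntegrableOn u (ann N k x) := by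
    intro k x
    have hfin : volume (ann N k x) ≠ ⊤ := by rw [hvol]; simp
    have h1 : IntegrableOn (fun y => 1 + |u y| ^ p) (ann N k x) :=
      (integrableOn_const hfin).add hui.integrableOn
    refine Integrable.mono' h1 hum.restrict (Eventually.of_forall fun y => ?_)
    rw [Real.norm_eq_abs]
    have h0 : 0 ≤ |u y| ^ p := by positivity
    rcases le_total |u y| 1 with h | h
    · linarith
    · have := Real.self_le_rpow_of_one_le h (by linarith : 1 ≤ p)
      linarith
  have hnorm' : gagP N s p u + ∫ x : RN N, |u x| ^ p ≤ A := hnorm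
  have hQ : ENNReal.ofReal (κ⁻¹) * (∫⁻ y, ‖u y‖ₑ ^ p) +
        ENNReal.ofReal (κ⁻¹ ^ 2 * 2 ^ (3 * N)) * gagE N s p u ≤ ENNReal.ofReal (C2 * A) := by
    rw [hLp, hgE, ← ENNReal.ofReal_mul (by positivity), ← ENNReal.ofReal_mul (by positivity),
      ← ENNReal.ofReal_add (by positivity) (by positivity)]
    apply ENNReal.ofReal_le_ofReal
    rw [hC2, add_mul]
    gcongr <;> linarith
  have hTQ : T ^ (p-1) * (C2 * A) ≤ (1/2:ℝ)^p := by
    rw [hA]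
    apply le_of_eq
    have : 0 < T ^ (p-1) := by positivity
    field_simp
  have hpt : ∀ x, ENNReal.ofReal (primF f (u x)) ≤
      ENNReal.ofReal (ε * |u x| ^ p) + ENNReal.ofReal ε * gE N s p u x := by
    intro x
    rcases lt_or_ge |u x| δ with h | h
    · exact (ENNReal.ofReal_le_ofReal ((hF (u x)).2.1 h)).trans le_self_add
    · refine le_trans ?_ le_add_self
      refine (ENNReal.ofReal_le_ofReal ((hF (u x)).2.2 h)).trans ?_
      rw [ENNReal.ofReal_mul hK.le]
      refine (mul_le_mul_right (core_ptwise hN hp hsp hκ hvol hloc (C2 * A) T α δ n0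
        (by positivity) hQ hT hTQ hT1 hδ hT2 x h) _).trans ?_
      rw [← mul_assoc, ← ENNReal.ofReal_mul hK.le]
      refine mul_le_mul' (ENNReal.ofReal_le_ofReal ?_) le_rfl
      linarith
  have hint : ∫⁻ x, ENNReal.ofReal (primF f (u x)) ≤
      ENNReal.ofReal (ε * sobNormP N s p u) := by
    calc _ ≤ ∫⁻ x, (ENNReal.ofReal (ε * |u x| ^ p) + ENNReal.ofReal ε * gE N s p u x) :=
          lintegral_mono hpt
      _ = ENNReal.ofReal (ε * ∫ x, |u x| ^ p) + ENNReal.ofReal ε * gagE N s p u := by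
          rw [lintegral_add_left' (hui.const_mul ε).aemeasurable.ennreal_ofReal,
            lintegral_const_mul' _ _ (by simp), ← gagE_eq, ← integral_const_mul,
            ofReal_integral_eq_lintegral_ofReal (hui.const_mul ε)
              (Eventually.of_forall fun x => by positivity)]
      _ = _ := by
          rw [hgE, ← ENNReal.ofReal_mul hε.le, ← ENNReal.ofReal_add (by positivity) (by positivity),
            sobNormP]
          congr 1; ring
  have hFc : Continuous (primF f) :=
    intervalIntegral.continuous_primitive (fun a b => hfc.intervalIntegrable a b) 0
  have hfin : ∫ x : RN N, primF f (u x) ≤ ε * sobNormP N s p u := by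
    rw [integral_eq_lintegral_of_nonneg_ae (Eventually.of_forall fun x => (hF (u x)).1)
      (hFc.comp_aestronglyMeasurable hum)]
    refine ENNReal.toReal_le_of_le_ofReal ?_ hint
    exact mul_nonneg hε.le (add_nonneg hG0 hI0)
  have hS0 : 0 ≤ sobNormP N s p u := add_nonneg hG0 hI0
  have he : 1 / p * sobNormP N s p u - ε * sobNormP N s p u - 1 / (2*p) * sobNormP N s p u
      = 1 / (4*p) * sobNormP N s p u := by rw [hεd]; field_simp; ring
  have he2 : 0 ≤ 1 / (4*p) * sobNormP N s p u := by positivity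
  unfold ene
  linarith

theorem mountain_pass_geometry_critical_exponential (N : ℕ) (s p : ℝ) (f : ℝ → ℝ)
    (hN : 2 ≤ N) (hs : s ∈ Set.Ioo (0:ℝ) 1) (hp : 2 ≤ p)
    (hsp : s * p = N)
    (hfc : Continuous f) (hodd : ∀ t : ℝ, f (-t) = -f t)
    (hf1 : hypF1 p f) (hf3 : hypF3 p f) (hf4 : ∃ α₀ > (0:ℝ), hypF4 N s f α₀) :
    ∃ β > (0:ℝ), ∃ ρ > (0:ℝ),
      (∀ u : RN N → ℝ, memWr N s p u → sobNorm N s p u = ρ → β ≤ ene N s p f u) ∧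
      (∀ u : RN N → ℝ, memWr N s p u → sobNorm N s p u ≤ ρ → 0 ≤ ene N s p f u) := by
 
  obtain ⟨ρ, hρ, h⟩ := ene_lower N s p f hN hs hp hsp hfc hodd hf1 hf3 hf4
  have hp0 : 0 < p := by linarith
  have hS0 : ∀ u, 0 ≤ sobNormP N s p u := fun u =>
    add_nonneg ENNReal.toReal_nonneg (integral_nonneg fun x => by positivity)
  have hpow : ∀ u, sobNorm N s p u ^ p = sobNormP N s p u := fun u => by
    rw [sobNorm, ← Real.rpow_mul (hS0 u), one_div, inv_mul_cancel₀ hp0.ne', Real.rpow_one]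
  refine ⟨1 / (2 * p) * ρ ^ p, by positivity, ρ, hρ, fun u hu hn => ?_, fun u hu hn => ?_⟩
  · have e : sobNormP N s p u = ρ ^ p := by rw [← hpow, hn]
    have := h u hu.1 e.le
    rwa [e] at this
  · have e : sobNormP N s p u ≤ ρ ^ p := by
      rw [← hpow]
      have : 0 ≤ sobNorm N s p u := Real.rpow_nonneg (hS0 u) _
      gcongr
    exact le_trans (mul_nonneg (by positivity) (hS0 u)) (h u hu.1 e)
end
end

section
/- Let s ∈ (0,1), p ∈ [2,∞), N ≥ 2 an integer with sp < N, and let f : ℝ → ℝ be an odd continuous function satisfying (f1) and (f2). Then there exist β > 0 and ρ > 0 such that I(u) ≥ β for every u ∈ W_r^{s,p}(ℝ^N) with ‖u‖_{s,p} = ρ, and I(u) ≥ 0 for every u ∈ W_r^{s,p}(ℝ^N) with ‖u‖_{s,p} ≤ ρ. -/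
open MeasureTheory Real Filter Topology Set

noncomputable section

/-- Pointwise lower bound for the inner Gagliardo integral. -/
lemma sob_point (N : ℕ) (hN : 1 ≤ N) (s p q σ k A : ℝ) (hp : 0 < p) (hq : 0 < q) (hσ0 : 0 ≤ σ)
    (hσ : s * p = N * σ) (hpq : p + q * σ = q) (u : RN N → ℝ)
    (hu : AEStronglyMeasurable u volume) (hA : 0 < A)
    (hAi : ∫⁻ y, ENNReal.ofReal ((min |u y| k) ^ q) ≤ ENNReal.ofReal A)
    (x : RN N) (hx : 0 < min |u x| k) :
    ENNReal.ofReal ((min |u x| k / 2) ^ q *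
      (((volume (Metric.ball (0 : RN N) 1)).toReal / 2) ^ (1 + σ) * A ^ (-σ))) ≤
    ∫⁻ y : RN N, ENNReal.ofReal (|u x - u y| ^ p / ‖x - y‖ ^ ((N : ℝ) + s * p)) := by
  set a := min |u x| k with ha
  have hNpos : (0 : ℝ) < N := by exact_mod_cast hN
  have hωpos : 0 < (volume (Metric.ball (0 : RN N) 1)).toReal :=
    ENNReal.toReal_pos (Metric.measure_ball_pos volume _ one_pos).ne' measure_ball_lt_top.ne
  set ω := (volume (Metric.ball (0 : RN N) 1)).toReal with hω
  have hωE : volume (Metric.ball (0 : RN N) 1) = ENNReal.ofReal ω :=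
    (ENNReal.ofReal_toReal measure_ball_lt_top.ne).symm
  have hum : AEMeasurable u volume := hu.aemeasurable
  have hk : 0 < k := lt_of_lt_of_le hx (min_le_right _ _)
  set M := A / (a / 2) ^ q with hM
  have ha2 : 0 < (a / 2) ^ q := by positivity
  have hMpos : 0 < M := by positivity
  set S : Set (RN N) := {y | a / 2 < min |u y| k} with hS
  have hSv : volume S ≤ ENNReal.ofReal M := by
    have h1 := mul_meas_ge_le_lintegral₀ (μ := volume)
      (f := fun y : RN N => ENNReal.ofReal ((min |u y| k) ^ q))
      (by fun_prop) (ENNReal.ofReal ((a / 2) ^ q))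
    have h2 : volume S ≤ volume {y : RN N | ENNReal.ofReal ((a / 2) ^ q) ≤
        ENNReal.ofReal ((min |u y| k) ^ q)} := by
      apply measure_mono
      intro y hy
      have hy : a / 2 < min |u y| k := hy
      apply ENNReal.ofReal_le_ofReal
      exact Real.rpow_le_rpow (by positivity) hy.le hq.le
    rw [hM, ENNReal.ofReal_div_of_pos ha2]
    rw [ENNReal.le_div_iff_mul_le (Or.inl (by simpa using ha2)) (Or.inl ENNReal.ofReal_ne_top)]
    rw [mul_comm]
    exact (mul_le_mul_right h2 _).trans (h1.trans hAi)
  set r := (2 * M / ω) ^ (1 / (N : ℝ)) with hr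
  have hrpos : 0 < r := by positivity
  have hrN : r ^ N = 2 * M / ω := by
    rw [hr, ← Real.rpow_natCast, ← Real.rpow_mul (by positivity)]
    rw [one_div_mul_cancel hNpos.ne', Real.rpow_one]
  have hrE : r ^ ((N : ℝ) + s * p) = (2 * M / ω) ^ (1 + σ) := by
    rw [hr, ← Real.rpow_mul (by positivity), hσ]
    congr 1
    field_simp
  have hball : volume (Metric.ball x r) = ENNReal.ofReal (2 * M) := by
    rw [Measure.addHaar_ball_of_pos _ _ hrpos, hωE, finrank_euclideanSpace_fin, hrN,
      ← ENNReal.ofReal_mul (by positivity)]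
    congr 1
    field_simp
  have hT : ENNReal.ofReal M ≤ volume (Metric.ball x r \ S) := by
    refine le_trans ?_ le_measure_sdiff
    rw [hball]
    refine le_trans ?_ (tsub_le_tsub_left hSv _)
    rw [← ENNReal.ofReal_sub _ hMpos.le]
    apply ENNReal.ofReal_le_ofReal; linarith
  set c := (a / 2) ^ p / r ^ ((N : ℝ) + s * p) with hc
  have h3 := mul_meas_ge_le_lintegral₀ (μ := volume)
      (f := fun y : RN N => ENNReal.ofReal (|u x - u y| ^ p / ‖x - y‖ ^ ((N : ℝ) + s * p)))
      (by fun_prop) (ENNReal.ofReal c)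
  have h4 : Metric.ball x r \ S ⊆ {y : RN N | ENNReal.ofReal c ≤
      ENNReal.ofReal (|u x - u y| ^ p / ‖x - y‖ ^ ((N : ℝ) + s * p))} := by
    rintro y ⟨hy1, hy2⟩
    have hy2 : min |u y| k ≤ a / 2 := not_lt.mp hy2
    have hd : a / 2 ≤ |u x - u y| := by
      have h5 := abs_sub_abs_le_abs_sub (u x) (u y)
      have h6 : a ≤ |u x| := min_le_left _ _
      have h7 : a ≤ k := min_le_right _ _
      rcases min_le_iff.mp hy2 with h | h <;> linarith
    have hxy : 0 < ‖x - y‖ := by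
      rw [norm_pos_iff, sub_ne_zero]
      rintro rfl
      rw [sub_self, abs_zero] at hd
      linarith
    have hyr : ‖x - y‖ ≤ r := by
      rw [Metric.mem_ball, dist_comm, dist_eq_norm] at hy1
      exact hy1.le
    apply ENNReal.ofReal_le_ofReal
    have he : 0 ≤ (N : ℝ) + s * p := by rw [hσ]; positivity
    rw [hc]
    gcongr
  refine le_trans ?_ h3
  refine le_trans ?_ (mul_le_mul_right (hT.trans (measure_mono h4)) _)
  rw [← ENNReal.ofReal_mul (by positivity)]
  apply ENNReal.ofReal_le_ofReal
  rw [hc, hrE]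
  have e1 : (2 * M / ω) ^ (1 + σ) = M * M ^ σ / (ω / 2) ^ (1 + σ) := by
    rw [show 2 * M / ω = M / (ω / 2) by field_simp, Real.div_rpow hMpos.le (by positivity),
      Real.rpow_add hMpos, Real.rpow_one]
  have e2 : M ^ σ = A ^ σ / (a / 2) ^ (q * σ) := by
    rw [hM, Real.div_rpow hA.le ha2.le, ← Real.rpow_mul (by positivity)]
  have e3 : (a / 2) ^ q = (a / 2) ^ p * (a / 2) ^ (q * σ) := by
    rw [← Real.rpow_add (by positivity), hpq]
  rw [e1, e2, e3, Real.rpow_neg hA.le]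
  have : 0 < A ^ σ := by positivity
  have : 0 < (a / 2) ^ (q * σ) := by positivity
  have : 0 < (ω / 2) ^ (1 + σ) := by positivity
  apply le_of_eq
  field_simp

/-- The fractional Sobolev inequality for truncations. -/
lemma sob_trunc (N : ℕ) (hN : 1 ≤ N) (s p q σ k : ℝ) (hp : 0 < p) (hq : 0 < q) (hσ0 : 0 ≤ σ)
    (hσ : s * p = N * σ) (hpq : p + q * σ = q) (u : RN N → ℝ) (hu : memW N s p u)
    (hk : 0 < k) :
    ∫⁻ y, ENNReal.ofReal ((min |u y| k) ^ q) ≤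
      ENNReal.ofReal (((2 ^ q / (((volume (Metric.ball (0 : RN N) 1)).toReal / 2) ^ (1 + σ))) *
        gagP N s p u) ^ (q / p)) := by
  have hωpos : 0 < (volume (Metric.ball (0 : RN N) 1)).toReal :=
    ENNReal.toReal_pos (Metric.measure_ball_pos volume _ one_pos).ne' measure_ball_lt_top.ne
  obtain ⟨hum, hup, hug⟩ := hu
  have hqp : p ≤ q := by nlinarith [mul_nonneg hq.le hσ0]
  set B := ((volume (Metric.ball (0 : RN N) 1)).toReal / 2) ^ (1 + σ) with hB
  have hBpos : 0 < B := by positivity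
  -- finiteness
  have hfin : ∫⁻ y, ENNReal.ofReal ((min |u y| k) ^ q) < ⊤ := by
    have h1 : ∀ y, ENNReal.ofReal ((min |u y| k) ^ q) ≤
        ENNReal.ofReal (k ^ (q - p)) * ENNReal.ofReal (|u y| ^ p) := by
      intro y
      rw [← ENNReal.ofReal_mul (by positivity)]
      apply ENNReal.ofReal_le_ofReal
      have h0 : 0 ≤ min |u y| k := le_min (abs_nonneg _) hk.le
      have : (min |u y| k) ^ q = (min |u y| k) ^ (q - p) * (min |u y| k) ^ p := by
        rw [← Real.rpow_add_of_nonneg h0 (by linarith) hp.le]; congr 1; ring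
      rw [this]
      have := min_le_left |u y| k
      have := min_le_right |u y| k
      have := sub_nonneg.mpr hqp
      gcongr
    refine lt_of_le_of_lt (lintegral_mono h1) ?_
    rw [lintegral_const_mul' _ _ ENNReal.ofReal_ne_top]
    refine ENNReal.mul_lt_top ENNReal.ofReal_lt_top ?_
    rw [← ofReal_integral_eq_lintegral_ofReal hup (ae_of_all _ fun y => by positivity)]
    exact ENNReal.ofReal_lt_top
  set A := (∫⁻ y, ENNReal.ofReal ((min |u y| k) ^ q)).toReal with hA
  have hAE : ∫⁻ y, ENNReal.ofReal ((min |u y| k) ^ q) = ENNReal.ofReal A :=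
    (ENNReal.ofReal_toReal hfin.ne).symm
  have hG0 : 0 ≤ gagP N s p u := ENNReal.toReal_nonneg
  have hA0 : 0 ≤ A := ENNReal.toReal_nonneg
  rw [hAE]
  apply ENNReal.ofReal_le_ofReal
  rcases hA0.eq_or_lt with h | hApos
  · rw [← h]; positivity
  have hAs : 0 < A ^ σ := by positivity
  have h2 : ∀ x, ENNReal.ofReal ((min |u x| k) ^ q) ≤ ENNReal.ofReal (2 ^ q / B * A ^ σ) *
      ∫⁻ y : RN N, ENNReal.ofReal (|u x - u y| ^ p / ‖x - y‖ ^ ((N : ℝ) + s * p)) := by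
    intro x
    have h0 : 0 ≤ min |u x| k := le_min (abs_nonneg _) hk.le
    rcases h0.eq_or_lt with h | hx
    · rw [← h, Real.zero_rpow hq.ne']; simp
    have h3 := sob_point N hN s p q σ k A hp hq hσ0 hσ hpq u hum hApos hAE.le x hx
    refine le_trans ?_ (mul_le_mul_right h3 _)
    rw [← ENNReal.ofReal_mul (by positivity)]
    apply ENNReal.ofReal_le_ofReal
    rw [← hB, Real.div_rpow h0 (by norm_num), Real.rpow_neg hA0]
    apply le_of_eq
    field_simp
  have h4 := lintegral_mono (μ := (volume : Measure (RN N))) h2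
  rw [lintegral_const_mul' _ _ ENNReal.ofReal_ne_top, hAE] at h4
  change _ ≤ _ * gagE N s p u at h4
  rw [← ENNReal.ofReal_toReal hug.ne, ← ENNReal.ofReal_mul (by positivity)] at h4
  rw [ENNReal.ofReal_le_ofReal_iff (by positivity)] at h4
  change A ≤ 2 ^ q / B * A ^ σ * gagP N s p u at h4
  have h5 : A ^ (p / q) ≤ 2 ^ q / B * gagP N s p u := by
    have e : p / q = 1 - σ := by field_simp; linarith
    rw [e, Real.rpow_sub hApos, Real.rpow_one, div_le_iff₀ hAs]
    linarith
  have h6 := Real.rpow_le_rpow (by positivity) h5 (by positivity : 0 ≤ q / p)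
  rw [← Real.rpow_mul hA0, div_mul_div_cancel₀ hq.ne', div_self hp.ne', Real.rpow_one] at h6
  exact h6

/-- The fractional Sobolev inequality. -/
lemma sob_ineq (N : ℕ) (hN : 1 ≤ N) (s p q σ : ℝ) (hp : 0 < p) (hq : 0 < q) (hσ0 : 0 ≤ σ)
    (hσ : s * p = N * σ) (hpq : p + q * σ = q) :
    ∃ C : ℝ, 0 < C ∧ ∀ u : RN N → ℝ, memW N s p u →
    ∫⁻ y, ENNReal.ofReal (|u y| ^ q) ≤ ENNReal.ofReal (C * (gagP N s p u) ^ (q / p)) := by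
  have hωpos : 0 < (volume (Metric.ball (0 : RN N) 1)).toReal :=
    ENNReal.toReal_pos (Metric.measure_ball_pos volume _ one_pos).ne' measure_ball_lt_top.ne
  refine ⟨(2 ^ q / (((volume (Metric.ball (0 : RN N) 1)).toReal / 2) ^ (1 + σ))) ^ (q / p),
    by positivity, ?_⟩
  intro u hu
  have hG0 : 0 ≤ gagP N s p u := ENNReal.toReal_nonneg
  rw [← Real.mul_rpow (by positivity) hG0]
  have hum := hu.1.aemeasurable
  have ht := lintegral_tendsto_of_tendsto_of_monotone (μ := volume)
    (f := fun (n : ℕ) (y : RN N) => ENNReal.ofReal ((min |u y| ((n : ℝ) + 1)) ^ q))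
    (F := fun y => ENNReal.ofReal (|u y| ^ q)) (fun n => by fun_prop)
    (ae_of_all _ fun y => by
      intro m n hmn
      have : (m : ℝ) ≤ n := by exact_mod_cast hmn
      have h0 : 0 ≤ min |u y| ((m : ℝ) + 1) := le_min (abs_nonneg _) (by positivity)
      dsimp only
      gcongr)
    (ae_of_all _ fun y => by
      apply tendsto_const_nhds.congr'
      obtain ⟨n0, hn0⟩ := exists_nat_ge |u y|
      filter_upwards [eventually_ge_atTop n0] with n hn
      have : (n0 : ℝ) ≤ n := by exact_mod_cast hn
      rw [min_eq_left (by linarith)])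
  exact le_of_tendsto' ht fun n => sob_trunc N hN s p q σ _ hp hq hσ0 hσ hpq u hu (by positivity)

/-- Growth bound of the nonlinearity. -/
lemma f_growth (p q : ℝ) (f : ℝ → ℝ) (hp : 2 ≤ p) (hq : p ≤ q) (hfc : Continuous f)
    (hodd : ∀ t : ℝ, f (-t) = -f t) (hf1 : hypF1 p f)
    (hf2 : ∀ᶠ t in atTop, f t ≤ 2 * t ^ (q - 1)) :
    ∃ K : ℝ, 0 < K ∧ ∀ t, 0 ≤ t → f t ≤ 1 / 2 * t ^ (p - 1) + K * t ^ (q - 1) := by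
  have h1 : ∀ᶠ t in 𝓝[≠] (0:ℝ), f t / (|t| ^ (p - 2) * t) < 1 / 2 :=
    hf1.eventually_lt_const (by norm_num)
  rw [eventually_nhdsWithin_iff, Metric.eventually_nhds_iff] at h1
  obtain ⟨δ, hδ, h1⟩ := h1
  obtain ⟨T, hT⟩ := eventually_atTop.mp hf2
  obtain ⟨M, hM⟩ := (isCompact_Icc (a := δ) (b := T)).bddAbove_image (f := f) hfc.continuousOn
  have hMM : ∀ t, δ ≤ t → t ≤ T → f t ≤ M := fun t a b => hM ⟨t, ⟨a, b⟩, rfl⟩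
  have hδq : 0 < δ ^ (q - 1) := by positivity
  refine ⟨2 + |M| / δ ^ (q - 1), by positivity, ?_⟩
  intro t ht
  have hK : 0 ≤ |M| / δ ^ (q - 1) := by positivity
  have htp : 0 ≤ t ^ (p - 1) := by positivity
  have htq : 0 ≤ t ^ (q - 1) := by positivity
  rcases ht.eq_or_lt with h | htpos
  · have := hodd 0
    rw [neg_zero] at this
    have h0 : f 0 = 0 := by linarith
    rw [← h, h0, Real.zero_rpow (by linarith), Real.zero_rpow (by linarith)]
    simp
  rcases lt_or_ge t δ with h | h
  · have h2 := h1 (y := t) (by rw [Real.dist_eq, sub_zero, abs_of_pos htpos]; exact h) htpos.ne'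
    have e : |t| ^ (p - 2) * t = t ^ (p - 1) := by
      rw [abs_of_pos htpos, show p - 1 = (p - 2) + 1 by ring, Real.rpow_add_one htpos.ne']
    rw [e, div_lt_iff₀ (by positivity)] at h2
    nlinarith [mul_nonneg hK htq]
  rcases le_total t T with h' | h'
  · have h2 := hMM t h h'
    have h3 : δ ^ (q - 1) ≤ t ^ (q - 1) := Real.rpow_le_rpow hδ.le h (by linarith)
    have h4 : |M| ≤ |M| / δ ^ (q - 1) * t ^ (q - 1) := by
      rw [div_mul_eq_mul_div, le_div_iff₀ hδq]
      gcongr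
    have := le_abs_self M
    nlinarith
  · have := hT t h'
    nlinarith [mul_nonneg hK htq]

/-- Growth bound of the primitive. -/
lemma F_growth (p q K : ℝ) (f : ℝ → ℝ) (hp : 2 ≤ p) (hq : p ≤ q) (hK : 0 < K)
    (hfc : Continuous f) (hodd : ∀ t : ℝ, f (-t) = -f t)
    (hf : ∀ t, 0 ≤ t → f t ≤ 1 / 2 * t ^ (p - 1) + K * t ^ (q - 1)) (t : ℝ) :
    primF f t ≤ 1 / (2 * p) * |t| ^ p + K / q * |t| ^ q := by
  have heven : primF f t = primF f |t| := by
    rcases abs_choice t with h | h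
    · rw [h]
    · rw [h]
      unfold primF
      have := intervalIntegral.integral_comp_neg (a := (0:ℝ)) (b := t) f
      rw [neg_zero] at this
      rw [intervalIntegral.integral_symm (-t) 0, ← this]
      simp [hodd]
  rw [heven]
  have h0 := abs_nonneg t
  set r := |t|
  unfold primF
  have hc1 : Continuous fun x : ℝ => x ^ (p - 1) :=
    Real.continuous_rpow_const (by linarith)
  have hc2 : Continuous fun x : ℝ => x ^ (q - 1) :=
    Real.continuous_rpow_const (by linarith)
  have h1 : ∫ τ in (0:ℝ)..r, f τ ≤ ∫ τ in (0:ℝ)..r, (1 / 2 * τ ^ (p - 1) + K * τ ^ (q - 1)) := by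
    apply intervalIntegral.integral_mono_on h0 (hfc.intervalIntegrable _ _)
    · exact (by fun_prop : Continuous fun τ : ℝ =>
        1 / 2 * τ ^ (p - 1) + K * τ ^ (q - 1)).intervalIntegrable _ _
    · intro x hx
      exact hf x hx.1
  refine h1.trans (le_of_eq ?_)
  rw [intervalIntegral.integral_add ((hc1.const_mul _).intervalIntegrable _ _)
    ((hc2.const_mul _).intervalIntegrable _ _),
    intervalIntegral.integral_const_mul, intervalIntegral.integral_const_mul,
    integral_rpow (Or.inl (by linarith)), integral_rpow (Or.inl (by linarith))]
  simp only [sub_add_cancel]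
  rw [Real.zero_rpow (by linarith), Real.zero_rpow (by linarith)]
  have : p ≠ 0 := by linarith
  have : q ≠ 0 := by linarith
  field_simp
  ring

theorem mountain_pass_geometry_subcritical (N : ℕ) (s p : ℝ) (f : ℝ → ℝ)
    (hN : 2 ≤ N) (hs : s ∈ Set.Ioo (0:ℝ) 1) (hp : 2 ≤ p)
    (hsp : s * p < N)
    (hfc : Continuous f) (hodd : ∀ t : ℝ, f (-t) = -f t)
    (hf1 : hypF1 p f) (hf2 : hypF2 N s p f) :
    ∃ β > (0:ℝ), ∃ ρ > (0:ℝ),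
      (∀ u : RN N → ℝ, memWr N s p u → sobNorm N s p u = ρ → β ≤ ene N s p f u) ∧
      (∀ u : RN N → ℝ, memWr N s p u → sobNorm N s p u ≤ ρ → 0 ≤ ene N s p f u) := by
  have hs0 : 0 < s := hs.1
  have hp0 : 0 < p := by linarith
  have hN0 : (0:ℝ) < N := by positivity
  have hd : 0 < (N:ℝ) - s * p := by linarith
  set q := p * N / ((N : ℝ) - s * p) with hq
  set σ := s * p / N with hσd
  have hσ0 : 0 < σ := by positivity
  have hq0 : 0 < q := by positivity
  have hσ : s * p = N * σ := by rw [hσd]; field_simp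
  have hpq : p + q * σ = q := by
    have h1 : q * ((N : ℝ) - s * p) = p * N := div_mul_cancel₀ _ hd.ne'
    rw [hσ] at h1
    have h2 : (N : ℝ) * (p + q * σ) = N * q := by linarith
    exact mul_left_cancel₀ hN0.ne' h2
  have hqp : p < q := by nlinarith [mul_pos hq0 hσ0]
  obtain ⟨C, hC, hsob⟩ := sob_ineq N (by omega) s p q σ hp0 hq0 hσ0.le hσ hpq
  have hf2' : ∀ᶠ t in atTop, f t ≤ 2 * t ^ (q - 1) := by
    have h1 : ∀ᶠ t : ℝ in atTop, ((f t / t ^ (q - 1) : ℝ) : EReal) < ((2 : ℝ) : EReal) := by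
      refine eventually_lt_of_limsup_lt ?_
      refine lt_of_le_of_lt hf2 ?_
      exact_mod_cast (by norm_num : (1:ℝ) < 2)
    filter_upwards [h1, eventually_gt_atTop 0] with t ht ht0
    rw [EReal.coe_lt_coe_iff, div_lt_iff₀ (by positivity)] at ht
    exact ht.le
  obtain ⟨K, hK, hfg⟩ := f_growth p q f hp hqp.le hfc hodd hf1 hf2'
  have hFg := F_growth p q K f hp hqp.le hK hfc hodd hfg
  set D := K / q * C with hD
  have hD0 : 0 < D := by positivity
  -- main lower bound
  have hmain : ∀ u : RN N → ℝ, memW N s p u → 0 ≤ sobNormP N s p u ∧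
      1 / (2 * p) * sobNormP N s p u - D * sobNormP N s p u ^ (q / p) ≤ ene N s p f u := by
    intro u hu
    have hG0 : 0 ≤ gagP N s p u := ENNReal.toReal_nonneg
    have hL0 : 0 ≤ ∫ x : RN N, |u x| ^ p := integral_nonneg fun x => by positivity
    have hn0 : 0 ≤ sobNormP N s p u := add_nonneg hG0 hL0
    refine ⟨hn0, ?_⟩
    have hGn : gagP N s p u ≤ sobNormP N s p u := by unfold sobNormP; linarith
    have hLn : ∫ x : RN N, |u x| ^ p ≤ sobNormP N s p u := by unfold sobNormP; linarith
    have hbd : ∫ x : RN N, primF f (u x) ≤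
        1 / (2 * p) * sobNormP N s p u + D * sobNormP N s p u ^ (q / p) := by
      by_cases hi : Integrable (fun x => primF f (u x)) volume
      · have hum := hu.1.aemeasurable
        have hqi : Integrable (fun x => |u x| ^ q) volume := by
          refine ⟨(by fun_prop : AEMeasurable (fun x => |u x| ^ q) volume).aestronglyMeasurable, ?_⟩
          rw [hasFiniteIntegral_iff_ofReal (ae_of_all _ fun x => by positivity)]
          exact lt_of_le_of_lt (hsob u hu) ENNReal.ofReal_lt_top
        have hqb : ∫ x, |u x| ^ q ≤ C * gagP N s p u ^ (q / p) := by
          have := hsob u hu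
          rw [← ofReal_integral_eq_lintegral_ofReal hqi (ae_of_all _ fun x => by positivity),
            ENNReal.ofReal_le_ofReal_iff (by positivity)] at this
          exact this
        have h2 : ∫ x : RN N, primF f (u x) ≤
            ∫ x : RN N, (1 / (2 * p) * |u x| ^ p + K / q * |u x| ^ q) :=
          integral_mono hi ((hu.2.1.const_mul _).add (hqi.const_mul _)) fun x => hFg (u x)
        rw [integral_add (hu.2.1.const_mul _) (hqi.const_mul _), integral_const_mul,
          integral_const_mul] at h2
        refine h2.trans ?_
        rw [hD, mul_assoc]
        have h3 : C * gagP N s p u ^ (q / p) ≤ C * sobNormP N s p u ^ (q / p) := by gcongr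
        have h4 := hqb.trans h3
        gcongr
      · rw [integral_undef hi]; positivity
    unfold ene
    have : 1 / p * sobNormP N s p u = 1 / (2 * p) * sobNormP N s p u +
      1 / (2 * p) * sobNormP N s p u := by field_simp; norm_num
    linarith
  have hθ : 0 < q / p - 1 := by rw [sub_pos, one_lt_div hp0]; exact hqp
  set n0 := (1 / (4 * p * D)) ^ (1 / (q / p - 1)) with hn0
  have hn0pos : 0 < n0 := by positivity
  have hkey : ∀ n : ℝ, 0 ≤ n → n ≤ n0 → 1 / (4 * p) * n ≤ 1 / (2 * p) * n - D * n ^ (q / p) := by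
    intro n h0 hn
    have h1 : n ^ (q / p) = n ^ (q / p - 1) * n := by
      rw [show q / p = (q / p - 1) + 1 by ring, Real.rpow_add_of_nonneg h0 hθ.le one_pos.le,
        Real.rpow_one]
      congr 2; ring
    have h2 : n ^ (q / p - 1) ≤ 1 / (4 * p * D) := by
      refine (Real.rpow_le_rpow h0 hn hθ.le).trans (le_of_eq ?_)
      rw [hn0, ← Real.rpow_mul (by positivity), one_div_mul_cancel hθ.ne', Real.rpow_one]
    have h3 : D * n ^ (q / p) ≤ 1 / (4 * p) * n := by
      rw [h1, ← mul_assoc]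
      gcongr
      calc D * n ^ (q / p - 1) ≤ D * (1 / (4 * p * D)) := by gcongr
        _ = 1 / (4 * p) := by field_simp
    have : 1 / (2 * p) * n = 1 / (4 * p) * n + 1 / (4 * p) * n := by field_simp; ring
    linarith
  have hpow : ∀ n : ℝ, 0 ≤ n → (n ^ (1 / p)) ^ p = n := fun n h => by
    rw [← Real.rpow_mul h, one_div_mul_cancel hp0.ne', Real.rpow_one]
  refine ⟨1 / (4 * p) * n0, by positivity, n0 ^ (1 / p), by positivity, ?_, ?_⟩
  · intro u hu hn
    obtain ⟨h0, h1⟩ := hmain u hu.1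
    have h2 : sobNormP N s p u = n0 := by
      rw [← hpow _ h0, ← hpow _ hn0pos.le, ← hn]; rfl
    rw [h2] at h1
    exact (hkey n0 hn0pos.le le_rfl).trans h1
  · intro u hu hn
    obtain ⟨h0, h1⟩ := hmain u hu.1
    have h2 : sobNormP N s p u ≤ n0 := by
      rw [← hpow _ h0, ← hpow _ hn0pos.le]
      exact Real.rpow_le_rpow (by positivity) hn hp0.le
    have h3 := hkey _ h0 h2
    have : 0 ≤ 1 / (4 * p) * sobNormP N s p u := by positivity
    linarith
end
end
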